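/- arXiv:1011.0422 — 5 statements merged into one kernel-verified Lean document; each statement's English description precedes it below -/
import Mathlib

section
/- Let n be a natural number and let A be an invertible n × n real matrix. Then the matrix t • 1 - A⁻¹ is invertible for every real number t if and only if the spectrum of A over ℝ is empty, i.e. A has no real eigenvalue. Consequently, the solution X(t) = (t • 1 - A⁻¹)⁻¹ of dX/dt = -X·X with initial condition A is defined for all real time if and only if the spectrum of A contains no real number. -/
open Matrix

/-- For an invertible `n × n` real matrix `A`, the matrix `t • 1 - A⁻¹` is invertible
for every real `t` iff the real spectrum of `A` is empty; i.e. the solution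
`X t = (t • 1 - A⁻¹)⁻¹` of `dX/dt = -X·X` is defined for all time iff `A` has no
real eigenvalue. -/
theorem stmt5 (n : ℕ) (A : Matrix (Fin n) (Fin n) ℝ) (hA : IsUnit A) :
    (∀ t : ℝ, IsUnit (t • (1 : Matrix (Fin n) (Fin n) ℝ) - A⁻¹)) ↔ spectrum ℝ A = ∅ := by
  obtain ⟨u, rfl⟩ := hA
  rw [← coe_units_inv, ← Set.inv_eq_empty, spectrum.map_inv, Set.eq_empty_iff_forall_notMem]
  simp only [spectrum.notMem_iff, Algebra.algebraMap_eq_smul_one]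
end

section
/- If n is an odd natural number, then every n × n real matrix A has a real eigenvalue, i.e. the spectrum of A over ℝ is nonempty. Consequently, in odd dimensions every invertible initial condition for the ODE dX/dt = -X·X leads to finite time blowup (forward or backward in time). -/
open Polynomial Filter in
/-- A monic real polynomial of odd degree has a real root. -/
theorem Polynomial.Monic.exists_isRoot_of_odd_natDegree {p : ℝ[X]} (hp : p.Monic)
    (hodd : Odd p.natDegree) : ∃ x, p.IsRoot x := by
  have hdeg : 0 < p.degree := natDegree_pos_iff_degree_pos.mp hodd.pos
  have htop : Tendsto (fun x ↦ p.eval x) atTop atTop :=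
    p.tendsto_atTop_of_leadingCoeff_nonneg hdeg (by simp [hp.leadingCoeff])
  have hnat : (p.comp (-X)).natDegree = p.natDegree := by simp [natDegree_comp]
  have hbot : Tendsto (fun x ↦ (p.comp (-X)).eval x) atTop atBot := by
    refine tendsto_atBot_of_leadingCoeff_nonpos _ ?_ ?_
    · exact natDegree_pos_iff_degree_pos.mp (hnat ▸ hodd.pos)
    · rw [leadingCoeff_comp (by simp)]
      simp [hp.leadingCoeff, hodd.neg_one_pow]
  obtain ⟨a, ha⟩ := (hbot.eventually_le_atBot 0).exists
  obtain ⟨b, hb⟩ := (htop.eventually_ge_atTop 0).exists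
  exact mem_range_of_exists_le_of_exists_ge p.continuous ⟨-a, by simpa using ha⟩ ⟨b, hb⟩

/-- In every odd dimension `n`, every `n × n` real matrix has a real eigenvalue:
its real spectrum is nonempty. -/
theorem stmt10 (n : ℕ) (hn : Odd n) (A : Matrix (Fin n) (Fin n) ℝ) :
    (spectrum ℝ A).Nonempty := by
  obtain ⟨x, hx⟩ := A.charpoly_monic.exists_isRoot_of_odd_natDegree
    (by simpa [A.charpoly_natDegree_eq_dim] using hn)
  exact ⟨x, A.mem_spectrum_iff_isRoot_charpoly.mpr hx⟩
end

section
/- Let n be a natural number and let S denote the unit sphere centered at the origin in the Euclidean space ℝ^{n+1}. If f : S → S is a continuous map satisfying f(-x) = f(x) for every x in S, then f has a fixed point: there exists x in S with f(x) = x. -/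
/-- Chains modulo two, spanned by finite tuples of points of `X`. -/
abbrev TupleChain (X : Type*) := List X →₀ ZMod 2

namespace TupleChain

variable {X Y : Type*}

/-- The cone operator, which prepends a point to every tuple. -/
noncomputable def cone (x : X) : TupleChain X →ₗ[ZMod 2] TupleChain X :=
  Finsupp.lmapDomain _ _ (List.cons x)

/-- The chain map induced by a map of points. -/
noncomputable def map (φ : X → Y) : TupleChain X →ₗ[ZMod 2] TupleChain Y :=
  Finsupp.lmapDomain _ _ (List.map φ)

/-- The boundary of a tuple: the sum of the tuples with one entry deleted. -/
noncomputable def boundaryTuple : List X → TupleChain X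
  | [] => 0
  | x :: l => Finsupp.single l 1 + cone x (boundaryTuple l)

/-- The (augmented) boundary operator. -/
noncomputable def boundary : TupleChain X →ₗ[ZMod 2] TupleChain X :=
  Finsupp.linearCombination _ boundaryTuple

/-- The prism over a tuple, between its images under `φ` and `ψ`. -/
noncomputable def prismTuple (φ ψ : X → Y) : List X → TupleChain Y
  | [] => 0
  | x :: l => Finsupp.single (φ x :: ψ x :: l.map ψ) 1 + cone (φ x) (prismTuple φ ψ l)

/-- The prism operator, a chain homotopy between `map φ` and `map ψ`. -/
noncomputable def prism (φ ψ : X → Y) : TupleChain X →ₗ[ZMod 2] TupleChain Y :=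
  Finsupp.linearCombination _ (prismTuple φ ψ)

@[simp] lemma cone_single (x : X) (l : List X) (a : ZMod 2) :
    cone x (Finsupp.single l a) = Finsupp.single (x :: l) a := by
  simp [cone]

@[simp] lemma map_single (φ : X → Y) (l : List X) (a : ZMod 2) :
    map φ (Finsupp.single l a) = Finsupp.single (l.map φ) a := by
  simp [map]

@[simp] lemma boundary_single (l : List X) :
    boundary (Finsupp.single l 1) = boundaryTuple l := by
  simp [boundary]

@[simp] lemma prism_single (φ ψ : X → Y) (l : List X) :
    prism φ ψ (Finsupp.single l 1) = prismTuple φ ψ l := by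
  simp [prism]

/-- Linear maps agreeing on a set of tuples agree on the chains supported there. -/
lemma eq_of_supported {M : Type*} [AddCommMonoid M] [Module (ZMod 2) M]
    {S T : TupleChain X →ₗ[ZMod 2] M} {s : Set (List X)}
    (h : ∀ l ∈ s, S (Finsupp.single l 1) = T (Finsupp.single l 1))
    {c : TupleChain X} (hc : c ∈ Finsupp.supported (ZMod 2) (ZMod 2) s) : S c = T c := by
  rw [Finsupp.supported_eq_span_single] at hc
  refine LinearMap.eqOn_span ?_ hc
  rintro _ ⟨l, hl, rfl⟩
  exact h l hl

lemma ext_single {M : Type*} [AddCommMonoid M] [Module (ZMod 2) M]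
    {S T : TupleChain X →ₗ[ZMod 2] M}
    (h : ∀ l, S (Finsupp.single l 1) = T (Finsupp.single l 1)) (c : TupleChain X) :
    S c = T c :=
  eq_of_supported (s := Set.univ) (fun l _ => h l) (by simp [Finsupp.supported_univ])

/-- A linear map sending a set of tuples into a submodule sends the chains supported there
into that submodule. -/
lemma apply_mem_of_supported {M : Type*} [AddCommMonoid M] [Module (ZMod 2) M]
    {T : TupleChain X →ₗ[ZMod 2] M} {s : Set (List X)} {p : Submodule (ZMod 2) M}
    (h : ∀ l ∈ s, T (Finsupp.single l 1) ∈ p)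
    {c : TupleChain X} (hc : c ∈ Finsupp.supported (ZMod 2) (ZMod 2) s) : T c ∈ p := by
  rw [Finsupp.supported_eq_span_single] at hc
  have : Submodule.span (ZMod 2) ((fun l => Finsupp.single l (1 : ZMod 2)) '' s) ≤ p.comap T := by
    rw [Submodule.span_le]
    rintro _ ⟨l, hl, rfl⟩
    exact h l hl
  exact this hc

lemma boundary_cone (x : X) (c : TupleChain X) :
    boundary (cone x c) = c + cone x (boundary c) :=
  ext_single (S := boundary ∘ₗ cone x) (T := LinearMap.id + cone x ∘ₗ boundary)
    (fun l => by simp [boundaryTuple]) c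

lemma boundary_boundary (c : TupleChain X) : boundary (boundary c) = 0 := by
  refine ext_single (S := boundary ∘ₗ boundary) (T := 0) (fun l => ?_) c
  induction l with
  | nil => simp [boundaryTuple]
  | cons x l ih =>
    simp only [LinearMap.comp_apply, boundary_single, LinearMap.zero_apply] at ih
    simp [boundaryTuple, boundary_cone, ih, ZModModule.add_self]

lemma map_cone (φ : X → Y) (x : X) (c : TupleChain X) :
    map φ (cone x c) = cone (φ x) (map φ c) :=
  ext_single (S := map φ ∘ₗ cone x) (T := cone (φ x) ∘ₗ map φ) (fun l => by simp) c

lemma boundary_map (φ : X → Y) (c : TupleChain X) :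
    boundary (map φ c) = map φ (boundary c) := by
  refine ext_single (S := boundary ∘ₗ map φ) (T := map φ ∘ₗ boundary) (fun l => ?_) c
  induction l with
  | nil => simp [boundaryTuple]
  | cons x l ih =>
    simp only [LinearMap.comp_apply, boundary_single, map_single] at ih
    simp [boundaryTuple, map_cone, ih]

lemma map_fun_id (c : TupleChain X) : map (fun x => x) c = c :=
  ext_single (S := map (fun x => x)) (T := LinearMap.id) (fun l => by simp) c

lemma map_map {Z : Type*} (ψ : Y → Z) (φ : X → Y) (c : TupleChain X) :
    map ψ (map φ c) = map (ψ ∘ φ) c :=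
  ext_single (S := map ψ ∘ₗ map φ) (T := map (ψ ∘ φ)) (fun l => by simp) c

lemma prism_cone (φ ψ : X → Y) (x : X) (c : TupleChain X) :
    prism φ ψ (cone x c) = cone (φ x) (cone (ψ x) (map ψ c)) + cone (φ x) (prism φ ψ c) :=
  ext_single (S := prism φ ψ ∘ₗ cone x)
    (T := cone (φ x) ∘ₗ cone (ψ x) ∘ₗ map ψ + cone (φ x) ∘ₗ prism φ ψ)
    (fun l => by simp [prismTuple]) c

lemma boundary_prism (φ ψ : X → Y) (c : TupleChain X) :
    boundary (prism φ ψ c) = map φ c + map ψ c + prism φ ψ (boundary c) := by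
  refine ext_single (S := boundary ∘ₗ prism φ ψ)
    (T := map φ + map ψ + prism φ ψ ∘ₗ boundary) (fun l => ?_) c
  induction l with
  | nil => simp [prismTuple, boundaryTuple, ZModModule.add_self]
  | cons x l ih =>
    have hb : boundaryTuple (l.map ψ) = map ψ (boundaryTuple l) := by
      simpa using boundary_map ψ (Finsupp.single l 1)
    simp only [LinearMap.comp_apply, LinearMap.add_apply, boundary_single, prism_single,
      map_single] at ih
    simp only [LinearMap.comp_apply, LinearMap.add_apply, boundary_single, prism_single,
      map_single, prismTuple, boundaryTuple, map_add, boundary_cone, prism_cone, ih, hb,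
      cone_single, List.map_cons]
    have h2 := ZModModule.add_self (Finsupp.single (φ x :: l.map ψ) (1 : ZMod 2))
    linear_combination (norm := module) h2

/-- The cup product of the coboundaries of the functions in a list, evaluated on a tuple. -/
def cupTuple : List (X → ZMod 2) → List X → ZMod 2
  | [], [_] => 1
  | θ :: θs, x :: y :: l => (θ x + θ y) * cupTuple θs (y :: l)
  | _, _ => 0

/-- The product of a function with a cup product of coboundaries, evaluated on a tuple. -/
def mulCupTuple (θ : X → ZMod 2) (θs : List (X → ZMod 2)) : List X → ZMod 2
  | [] => 0
  | x :: l => θ x * cupTuple θs (x :: l)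

/-- The cochain `δθ₁ ∪ ⋯ ∪ δθₘ`. -/
noncomputable def cup (θs : List (X → ZMod 2)) : TupleChain X →ₗ[ZMod 2] ZMod 2 :=
  Finsupp.linearCombination _ (cupTuple θs)

/-- The cochain `θ ∪ δθ₁ ∪ ⋯ ∪ δθₘ`. -/
noncomputable def mulCup (θ : X → ZMod 2) (θs : List (X → ZMod 2)) :
    TupleChain X →ₗ[ZMod 2] ZMod 2 :=
  Finsupp.linearCombination _ (mulCupTuple θ θs)

@[simp] lemma cup_single (θs : List (X → ZMod 2)) (l : List X) :
    cup θs (Finsupp.single l 1) = cupTuple θs l := by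
  simp [cup]

@[simp] lemma mulCup_single (θ : X → ZMod 2) (θs : List (X → ZMod 2)) (l : List X) :
    mulCup θ θs (Finsupp.single l 1) = mulCupTuple θ θs l := by
  simp [mulCup]

lemma mulCup_cone (θ : X → ZMod 2) (θs : List (X → ZMod 2)) (x : X) (c : TupleChain X) :
    mulCup θ θs (cone x c) = θ x * cup θs (cone x c) :=
  ext_single (S := mulCup θ θs ∘ₗ cone x) (T := θ x • (cup θs ∘ₗ cone x))
    (fun l => by simp [mulCupTuple]) c

lemma cup_cons_of_cup_boundary {θs : List (X → ZMod 2)}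
    (h : ∀ c, cup θs (boundary c) = 0) (θ : X → ZMod 2) (c : TupleChain X) :
    cup (θ :: θs) c = mulCup θ θs (boundary c) := by
  refine ext_single (S := cup (θ :: θs)) (T := mulCup θ θs ∘ₗ boundary) (fun l => ?_) c
  match l with
  | [] => simp [boundaryTuple, cupTuple]
  | [x] => simp [boundaryTuple, cupTuple, mulCupTuple]
  | x :: y :: l =>
    have h' := h (Finsupp.single (x :: y :: l) 1)
    rw [boundary_single, boundaryTuple, map_add, cup_single] at h'
    have h'' : cup θs (cone x (boundaryTuple (y :: l))) = cupTuple θs (y :: l) := by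
      have := CharTwo.add_self_eq_zero (cupTuple θs (y :: l))
      linear_combination h' - this
    rw [LinearMap.comp_apply, boundary_single, boundaryTuple, map_add, mulCup_cone, h'',
      cup_single, mulCup_single, cupTuple, mulCupTuple]
    ring

lemma cup_boundary (θs : List (X → ZMod 2)) (c : TupleChain X) : cup θs (boundary c) = 0 := by
  induction θs generalizing c with
  | nil =>
    refine ext_single (S := cup [] ∘ₗ boundary) (T := 0) (fun l => ?_) c
    match l with
    | [] => simp [boundaryTuple]
    | [x] => simp [boundaryTuple, cupTuple]
    | [x, y] => simp [boundaryTuple, cupTuple, CharTwo.add_self_eq_zero]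
    | x :: y :: z :: l =>
      have : cup [] ∘ₗ cone x ∘ₗ cone y = 0 := by
        ext l
        simp [cupTuple]
      have h := LinearMap.congr_fun this (boundaryTuple (z :: l))
      simp only [LinearMap.comp_apply, LinearMap.zero_apply] at h
      simp [boundaryTuple, cupTuple] at h ⊢
      simp [h]
  | cons θ θs ih => rw [cup_cons_of_cup_boundary ih, boundary_boundary, map_zero]

/-- The coboundary formula `δ(θ ∪ δθ₁ ∪ ⋯ ∪ δθₘ) = δθ ∪ δθ₁ ∪ ⋯ ∪ δθₘ`. -/
lemma cup_cons (θ : X → ZMod 2) (θs : List (X → ZMod 2)) (c : TupleChain X) :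
    cup (θ :: θs) c = mulCup θ θs (boundary c) :=
  cup_cons_of_cup_boundary (cup_boundary θs) θ c

lemma exists_ne_of_cupTuple_ne_zero {θs : List (X → ZMod 2)} {l : List X}
    (h : cupTuple θs l ≠ 0) {θ : X → ZMod 2} (hθ : θ ∈ θs) :
    ∃ x ∈ l, ∃ y ∈ l, θ x ≠ θ y := by
  induction θs generalizing l with
  | nil => simp at hθ
  | cons θ' θs ih =>
    match l with
    | [] => simp [cupTuple] at h
    | [x] => simp [cupTuple] at h
    | x :: y :: l =>
      rw [cupTuple] at h
      rcases List.mem_cons.1 hθ with rfl | hθ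
      · refine ⟨x, by simp, y, by simp, fun hxy => left_ne_zero_of_mul h ?_⟩
        rw [hxy, CharTwo.add_self_eq_zero]
      · obtain ⟨a, ha, b, hb, hab⟩ := ih (right_ne_zero_of_mul h) hθ
        exact ⟨a, List.mem_cons_of_mem _ ha, b, List.mem_cons_of_mem _ hb, hab⟩

/-- If all the functions change by one under an involution `a`, the cup product is
invariant under `a`. -/
lemma cupTuple_map {a : X → X} {s : Set X} {θs : List (X → ZMod 2)}
    (h : ∀ θ ∈ θs, ∀ x ∈ s, θ (a x) = θ x + 1) {l : List X} (hl : ∀ x ∈ l, x ∈ s) :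
    cupTuple θs (l.map a) = cupTuple θs l := by
  induction θs generalizing l with
  | nil =>
    match l with
    | [] => rfl
    | [x] => rfl
    | x :: y :: l => rfl
  | cons θ θs ih =>
    match l with
    | [] => rfl
    | [x] => rfl
    | x :: y :: l =>
      have := ih (fun θ hθ => h θ (by simp [hθ])) (l := y :: l)
        (fun x hx => hl x (List.mem_cons_of_mem _ hx))
      simp only [List.map_cons, cupTuple] at this ⊢
      rw [this, h θ (by simp) x (hl x (by simp)), h θ (by simp) y (hl y (by simp))]
      have h2 : (1 + 1 : ZMod 2) = 0 := by decide
      linear_combination cupTuple θs (y :: l) * h2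

/-- Evaluation of `θ ∪ δθ₁ ∪ ⋯ ∪ δθₘ` on a symmetrized chain. -/
lemma mulCup_add_map {a : X → X} {s : Set X} {θ : X → ZMod 2} {θs : List (X → ZMod 2)}
    (h : ∀ θ' ∈ θ :: θs, ∀ x ∈ s, θ' (a x) = θ' x + 1) {c : TupleChain X}
    (hc : c ∈ Finsupp.supported (ZMod 2) (ZMod 2) {l : List X | ∀ x ∈ l, x ∈ s}) :
    mulCup θ θs (c + map a c) = cup θs c := by
  refine eq_of_supported (S := mulCup θ θs ∘ₗ (LinearMap.id + map a)) (T := cup θs)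
    (fun l hl => ?_) hc
  match l with
  | [] => cases θs <;> simp [mulCupTuple, cupTuple]
  | x :: l =>
    have := cupTuple_map (fun θ hθ => h θ (List.mem_cons_of_mem _ hθ)) hl
    simp only [List.map_cons] at this
    simp only [LinearMap.comp_apply, LinearMap.add_apply, LinearMap.id_apply, map_add,
      map_single, mulCup_single, cup_single, List.map_cons, mulCupTuple, this]
    rw [h θ (by simp) x (hl x (by simp))]
    have h2 := CharTwo.add_self_eq_zero (θ x)
    linear_combination cupTuple θs (x :: l) * h2

lemma prismTuple_mem_supported (φ ψ : X → Y) (l : List X) :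
    prismTuple φ ψ l ∈ Finsupp.supported (ZMod 2) (ZMod 2)
      {l' : List Y | ∀ y ∈ l', ∃ x ∈ l, y = φ x ∨ y = ψ x} := by
  induction l with
  | nil => exact zero_mem _
  | cons x l ih =>
    refine add_mem (Finsupp.single_mem_supported _ _ ?_) (apply_mem_of_supported ?_ ih)
    · intro y hy
      simp only [List.mem_cons, List.mem_map] at hy
      rcases hy with rfl | rfl | ⟨z, hz, rfl⟩
      · exact ⟨x, by simp, Or.inl rfl⟩
      · exact ⟨x, by simp, Or.inr rfl⟩
      · exact ⟨z, by simp [hz], Or.inr rfl⟩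
    · intro l' hl'
      rw [cone_single]
      refine Finsupp.single_mem_supported _ _ fun y hy => ?_
      rcases List.mem_cons.1 hy with rfl | hy
      · exact ⟨x, by simp, Or.inl rfl⟩
      · obtain ⟨z, hz, h⟩ := hl' y hy
        exact ⟨z, List.mem_cons_of_mem _ hz, h⟩

section Metric

variable [PseudoMetricSpace X] [PseudoMetricSpace Y]

/-- The chains of tuples in `A` whose points are at mutual distance less than `ε`. -/
def small (A : Set X) (ε : ℝ) : Submodule (ZMod 2) (TupleChain X) :=
  Finsupp.supported (ZMod 2) (ZMod 2)
    {l | (∀ x ∈ l, x ∈ A) ∧ ∀ x ∈ l, ∀ y ∈ l, dist x y < ε}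

lemma small_mono {A B : Set X} {δ ε : ℝ} (hAB : A ⊆ B) (h : δ ≤ ε) : small A δ ≤ small B ε :=
  Finsupp.supported_mono fun _ hl =>
    ⟨fun x hx => hAB (hl.1 x hx), fun x hx y hy => (hl.2 x hx y hy).trans_le h⟩

lemma small_le_supported {A s : Set X} (hAs : A ⊆ s) (ε : ℝ) :
    small A ε ≤ Finsupp.supported (ZMod 2) (ZMod 2) {l | ∀ x ∈ l, x ∈ s} :=
  Finsupp.supported_mono fun _ hl x hx => hAs (hl.1 x hx)

lemma map_mem_small {A : Set X} {B : Set Y} {δ ε : ℝ} {φ : X → Y} (hφ : Set.MapsTo φ A B)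
    (hd : ∀ x ∈ A, ∀ y ∈ A, dist x y < δ → dist (φ x) (φ y) < ε)
    {c : TupleChain X} (hc : c ∈ small A δ) : map φ c ∈ small B ε := by
  refine apply_mem_of_supported (fun l hl => ?_) hc
  rw [map_single]
  refine Finsupp.single_mem_supported _ _ ⟨fun y hy => ?_, fun y hy y' hy' => ?_⟩
  · obtain ⟨x, hx, rfl⟩ := List.mem_map.1 hy
    exact hφ (hl.1 x hx)
  · obtain ⟨x, hx, rfl⟩ := List.mem_map.1 hy
    obtain ⟨x', hx', rfl⟩ := List.mem_map.1 hy'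
    exact hd x (hl.1 x hx) x' (hl.1 x' hx') (hl.2 x hx x' hx')

/-- The two ends of a homotopy, applied to a sufficiently small cycle, bound a small chain in
the image of the homotopy. -/
lemma exists_boundary_eq_of_homotopy {A : Set X} (hA : IsCompact A) {H : X × ℝ → Y}
    (hH : ContinuousOn H (A ×ˢ Set.Icc 0 1)) {ε : ℝ} (hε : 0 < ε) :
    ∃ δ > 0, ∀ c ∈ small A δ, boundary c = 0 →
      ∃ D ∈ small (H '' (A ×ˢ Set.Icc 0 1)) ε,
        boundary D = map (fun x => H (x, 0)) c + map (fun x => H (x, 1)) c := by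
  have hu := (hA.prod isCompact_Icc).uniformContinuousOn_of_continuous hH
  obtain ⟨δ, hδ, hd⟩ := Metric.uniformContinuousOn_iff.1 hu ε hε
  obtain ⟨N, hN⟩ := exists_nat_one_div_lt hδ
  refine ⟨δ, hδ, fun c hc hc0 => ?_⟩
  have hN0 : (0 : ℝ) < N + 1 := by positivity
  let φ : ℕ → X → Y := fun j x => H (x, j / (N + 1))
  have key : ∀ m ≤ N + 1, ∃ D ∈ small (H '' (A ×ˢ Set.Icc 0 1)) ε,
      boundary D = map (φ 0) c + map (φ m) c := by
    intro m
    induction m with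
    | zero => exact fun _ => ⟨0, zero_mem _, by rw [map_zero, ZModModule.add_self]⟩
    | succ m ih =>
      intro hm
      obtain ⟨D, hD, hbD⟩ := ih (by omega)
      have hm' : (m : ℝ) + 1 ≤ N + 1 := by exact_mod_cast hm
      have hmem : ((m : ℝ) / (N + 1)) ∈ Set.Icc (0 : ℝ) 1 :=
        ⟨by positivity, (div_le_one hN0).2 (by linarith)⟩
      have hmem' : (((m + 1 : ℕ) : ℝ) / (N + 1)) ∈ Set.Icc (0 : ℝ) 1 :=
        ⟨by positivity, (div_le_one hN0).2 (by push_cast; linarith)⟩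
      have hdiff : ((m + 1 : ℕ) : ℝ) / (N + 1) - m / (N + 1) = 1 / (N + 1) := by
        push_cast; ring
      refine ⟨D + prism (φ m) (φ (m + 1)) c, add_mem hD ?_, ?_⟩
      · refine apply_mem_of_supported (fun l hl => ?_) hc
        rw [prism_single]
        refine Finsupp.supported_mono ?_ (prismTuple_mem_supported _ _ l)
        have haux : ∀ l' : List Y, (∀ y ∈ l', ∃ x ∈ l, y = φ m x ∨ y = φ (m + 1) x) →
            ∀ y ∈ l', ∃ x ∈ l, ∃ s ∈ Set.Icc (0 : ℝ) 1, y = H (x, s) ∧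
              (s = m / (N + 1) ∨ s = (m + 1 : ℕ) / (N + 1)) := by
          intro l' hl' y hy
          obtain ⟨x, hx, h | h⟩ := hl' y hy
          · exact ⟨x, hx, _, hmem, h, Or.inl rfl⟩
          · exact ⟨x, hx, _, hmem', h, Or.inr rfl⟩
        refine fun l' hl' => ⟨fun y hy => ?_, fun y hy y' hy' => ?_⟩
        · obtain ⟨x, hx, s, hs, rfl, -⟩ := haux l' hl' y hy
          exact ⟨(x, s), ⟨hl.1 x hx, hs⟩, rfl⟩
        · obtain ⟨x, hx, s, hs, rfl, hs1⟩ := haux l' hl' y hy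
          obtain ⟨x', hx', s', hs', rfl, hs1'⟩ := haux l' hl' y' hy'
          refine hd _ ⟨hl.1 x hx, hs⟩ _ ⟨hl.1 x' hx', hs'⟩ ?_
          rw [Prod.dist_eq, max_lt_iff]
          refine ⟨hl.2 x hx x' hx', lt_of_le_of_lt ?_ hN⟩
          have hN1 : (0 : ℝ) ≤ 1 / (N + 1) := by positivity
          simp only [Real.dist_eq, abs_le]
          rcases hs1 with h | h <;> rcases hs1' with h' | h' <;> constructor <;> linarith
      · rw [map_add, hbD, boundary_prism, hc0, map_zero]
        have := ZModModule.add_self (map (φ m) c)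
        linear_combination (norm := module) this
  obtain ⟨D, hD, hbD⟩ := key (N + 1) le_rfl
  refine ⟨D, hD, hbD.trans ?_⟩
  have h1 : ((N : ℝ) + 1) / (N + 1) = 1 := div_self hN0.ne'
  simp [φ, h1]

end Metric

end TupleChain

section Sphere

open TupleChain

variable {n : ℕ}

/-- The `ℓ¹` unit sphere of `ℝ^{k+1}`, inside `ℝ^{n+1}`. -/
def l1Sphere (n k : ℕ) : Set (EuclideanSpace ℝ (Fin (n + 1))) :=
  {x | ∑ i, |x i| = 1 ∧ ∀ i, k < i.val → x i = 0}

lemma norm_le_sum_abs {ι : Type*} [Fintype ι] (x : EuclideanSpace ℝ ι) :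
    ‖x‖ ≤ ∑ i, |x i| := by
  rw [EuclideanSpace.norm_eq, Real.sqrt_le_left (by positivity)]
  simpa using Finset.sum_sq_le_sq_sum_of_nonneg (s := Finset.univ) (f := fun i => |x i|)
    (fun i _ => abs_nonneg _)

lemma isCompact_l1Sphere (n k : ℕ) : IsCompact (l1Sphere n k) := by
  refine Metric.isCompact_of_isClosed_isBounded ?_ ?_
  · refine IsClosed.inter (isClosed_eq (by fun_prop) (by fun_prop)) ?_
    change IsClosed {x : EuclideanSpace ℝ (Fin (n + 1)) | ∀ i, k < i.val → x i = 0}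
    simp only [Set.ofPred_forall]
    exact isClosed_iInter fun i => isClosed_iInter fun _ =>
      isClosed_eq (by fun_prop) (by fun_prop)
  · refine Metric.isBounded_closedBall (x := 0) (r := 1) |>.subset fun x hx => ?_
    rw [mem_closedBall_zero_iff]
    exact (norm_le_sum_abs x).trans hx.1.le

lemma ne_zero_of_mem_l1Sphere {k : ℕ} {x : EuclideanSpace ℝ (Fin (n + 1))}
    (hx : x ∈ l1Sphere n k) : x ≠ 0 := by
  rintro rfl
  simpa using hx.1

lemma neg_mem_l1Sphere {k : ℕ} {x : EuclideanSpace ℝ (Fin (n + 1))}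
    (hx : x ∈ l1Sphere n k) : -x ∈ l1Sphere n k :=
  ⟨by simpa using hx.1, fun i hi => by simpa using hx.2 i hi⟩

lemma single_mem_l1Sphere {k : ℕ} (i : Fin (n + 1)) (hi : i.val ≤ k) :
    EuclideanSpace.single i (1 : ℝ) ∈ l1Sphere n k := by
  refine ⟨?_, fun j hj => ?_⟩
  · simp [apply_ite abs]
  · have : j ≠ i := fun h => by subst h; omega
    simp [this]

lemma segment_mem_l1Sphere {k : ℕ} (hk : k + 1 < n + 1) {x : EuclideanSpace ℝ (Fin (n + 1))}
    (hx : x ∈ l1Sphere n k) {s : ℝ} (hs : s ∈ Set.Icc (0 : ℝ) 1) :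
    (1 - s) • x + s • EuclideanSpace.single ⟨k + 1, hk⟩ (1 : ℝ) ∈ l1Sphere n (k + 1) := by
  set e : EuclideanSpace ℝ (Fin (n + 1)) := EuclideanSpace.single ⟨k + 1, hk⟩ (1 : ℝ) with he
  have hmem : e ∈ l1Sphere n (k + 1) := single_mem_l1Sphere _ le_rfl
  refine ⟨?_, fun i hi => ?_⟩
  · have : ∀ i, |((1 - s) • x + s • e) i| = (1 - s) * |x i| + s * |e i| := by
      intro i
      have h1 := abs_of_nonneg hs.1
      have h2 : |1 - s| = 1 - s := abs_of_nonneg (by linarith [hs.2])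
      by_cases hik : i = ⟨k + 1, hk⟩
      · have : x i = 0 := hx.2 i (by simp [hik])
        simp [this, abs_mul, h1]
      · have : e i = 0 := by simp [he, hik]
        simp [this, abs_mul, h2]
    simp only [this, Finset.sum_add_distrib, ← Finset.mul_sum, hx.1, hmem.1]
    ring
  · have h1 : x i = 0 := hx.2 i (by omega)
    have h2 : e i = 0 := hmem.2 i hi
    simp [h1, h2]

/-- The chain `z + (-z)` is a fine fundamental cycle of the sphere, and `z` pairs to one with
every product of coboundaries of odd functions. -/
lemma exists_hemisphere_chain (n k : ℕ) (hk : k ≤ n) {ε : ℝ} (hε : 0 < ε) :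
    ∃ z ∈ small (l1Sphere n k) ε, boundary (z + map (fun x => -x) z) = 0 ∧
      ∀ θs : List (EuclideanSpace ℝ (Fin (n + 1)) → ZMod 2), θs.length = k →
        (∀ θ ∈ θs, ∀ x, x ≠ 0 → θ (-x) = θ x + 1) → cup θs z = 1 := by
  induction k generalizing ε with
  | zero =>
    refine ⟨Finsupp.single [EuclideanSpace.single 0 1] 1,
      Finsupp.single_mem_supported _ _ ⟨?_, ?_⟩, ?_, fun θs hθs _ => ?_⟩
    · simpa using single_mem_l1Sphere (n := n) (k := 0) 0 le_rfl
    · simpa using hε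
    · simp [boundaryTuple, ZModModule.add_self]
    · rw [List.length_eq_zero_iff.1 hθs, cup_single, cupTuple]
  | succ k ih =>
    set p : EuclideanSpace ℝ (Fin (n + 1)) := EuclideanSpace.single ⟨k + 1, by omega⟩ 1
      with hp
    have hpmem : p ∈ l1Sphere n (k + 1) := single_mem_l1Sphere _ le_rfl
    have hH : Continuous fun q : EuclideanSpace ℝ (Fin (n + 1)) × ℝ =>
      (1 - q.2) • q.1 + q.2 • p := by fun_prop
    obtain ⟨δ, hδ, hD⟩ :=
      exists_boundary_eq_of_homotopy (isCompact_l1Sphere n k) hH.continuousOn hε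
    obtain ⟨z, hz, hz0, hz1⟩ := ih (by omega) hδ
    have hc : z + map (fun x => -x) z ∈ small (l1Sphere n k) δ :=
      add_mem hz (map_mem_small (fun x hx => neg_mem_l1Sphere hx)
        (fun x _ y _ h => by rwa [dist_neg_neg]) hz)
    obtain ⟨D, hDs, hbD⟩ := hD _ hc hz0
    set c := z + map (fun x => -x) z with hcdef
    simp only [sub_zero, one_smul, zero_smul, add_zero, sub_self, zero_add] at hbD
    rw [map_fun_id] at hbD
    set w := map (fun _ => p) c with hw
    have hb : boundary (D + cone p w) = c := by
      rw [map_add, boundary_cone, hbD, hw, boundary_map, hz0, map_zero, map_zero, ← hw]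
      linear_combination (norm := module) ZModModule.add_self w
    refine ⟨D + cone p w, add_mem (small_mono ?_ le_rfl hDs) ?_, ?_, ?_⟩
    · rintro _ ⟨⟨x, s⟩, ⟨hx, hs⟩, rfl⟩
      exact segment_mem_l1Sphere _ hx hs
    · refine apply_mem_of_supported (T := cone p ∘ₗ map fun _ => p) (fun l _ => ?_) hc
      have hall : ∀ x ∈ p :: l.map (fun _ => p), x = p := by simp
      simp only [LinearMap.comp_apply, map_single, cone_single]
      refine Finsupp.single_mem_supported _ _
        ⟨fun x hx => hall x hx ▸ hpmem, fun x hx y hy => ?_⟩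
      rw [hall x hx, hall y hy, dist_self]
      exact hε
    · have hinv : map (fun x => -x) c = c := by
        have : (fun x : EuclideanSpace ℝ (Fin (n + 1)) => -x) ∘ (fun x => -x) = fun x => x := by
          ext1; simp
        rw [hcdef, map_add, map_map, this, map_fun_id, add_comm z]
      rw [map_add, boundary_map, hb, hinv, ZModModule.add_self]
    · rintro (_ | ⟨θ, θs⟩) hlen hodd
      · simp at hlen
      · rw [cup_cons, hb, mulCup_add_map (s := {x | x ≠ 0}) hodd]
        · exact hz1 θs (by simpa using hlen) fun θ hθ => hodd θ (by simp [hθ])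
        · exact small_le_supported (fun x hx => ne_zero_of_mem_l1Sphere hx) _ hz

lemma exists_odd_of_linearOrder (L : Type*) [AddCommGroup L] [LinearOrder L]
    [IsOrderedAddMonoid L] : ∃ η : L → ZMod 2, ∀ x, x ≠ 0 → η (-x) = η x + 1 := by
  refine ⟨fun x => if 0 < x then 1 else 0, fun x hx => ?_⟩
  dsimp only
  rcases lt_or_gt_of_ne hx with h | h
  · rw [if_pos (neg_pos.2 h), if_neg h.not_gt, zero_add]
  · rw [if_neg (neg_neg_of_pos h).not_gt, if_pos h]
    decide

/-- The indicator of a half-space, with ties broken by the lexicographic order so as to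
change by one under the antipodal map away from the origin. -/
lemma exists_odd_sign (i : Fin (n + 1)) :
    ∃ θ : EuclideanSpace ℝ (Fin (n + 1)) → ZMod 2, (∀ x, x ≠ 0 → θ (-x) = θ x + 1) ∧
      (∀ x, 0 < x i → θ x = 1) ∧ ∀ x, x i < 0 → θ x = 0 := by
  classical
  obtain ⟨η', hη'⟩ := exists_odd_of_linearOrder (Lex (Fin (n + 1) → ℝ))
  obtain ⟨η, hη⟩ : ∃ η : EuclideanSpace ℝ (Fin (n + 1)) → ZMod 2,
      ∀ x, x ≠ 0 → η (-x) = η x + 1 :=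
    ⟨fun x => η' (toLex x.ofLp), fun x hx =>
      hη' (toLex x.ofLp) fun h => hx (by ext j; exact congrFun h j)⟩
  refine ⟨fun x => if 0 < x i then 1 else if x i < 0 then 0 else η x, fun x hx => ?_,
    fun x hx => by simp [hx], fun x hx => by simp [hx, hx.not_gt]⟩
  rcases lt_trichotomy (x i) 0 with h | h | h
  · simp [h, h.not_gt]
  · simp [h, hη x hx]
  · have : (1 + 1 : ZMod 2) = 0 := by decide
    simp [h, h.not_gt, this]

/-- The straight-line homotopy from the inclusion of the sphere to an even map hits the
origin. -/
lemma exists_segment_eq_zero_of_even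
    {G : EuclideanSpace ℝ (Fin (n + 1)) → EuclideanSpace ℝ (Fin (n + 1))}
    (hG : ContinuousOn G {x | x ≠ 0}) (heven : ∀ x, G (-x) = G x) :
    ∃ x ≠ 0, ∃ s ∈ Set.Icc (0 : ℝ) 1, (1 - s) • x + s • G x = 0 := by
  by_contra! hne
  set H : EuclideanSpace ℝ (Fin (n + 1)) × ℝ → EuclideanSpace ℝ (Fin (n + 1)) :=
    fun q => (1 - q.2) • q.1 + q.2 • G q.1 with hHdef
  have hH : ContinuousOn H (l1Sphere n n ×ˢ Set.Icc 0 1) := by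
    have : ContinuousOn (fun q : EuclideanSpace ℝ (Fin (n + 1)) × ℝ => G q.1)
        (l1Sphere n n ×ˢ Set.Icc 0 1) :=
      hG.comp continuousOn_fst fun q hq => ne_zero_of_mem_l1Sphere hq.1
    exact ((continuousOn_const.sub continuousOn_snd).smul continuousOn_fst).add
      (continuousOn_snd.smul this)
  have hK := ((isCompact_l1Sphere n n).prod isCompact_Icc).image_of_continuousOn hH
  have h0 : (0 : EuclideanSpace ℝ (Fin (n + 1))) ∉ H '' (l1Sphere n n ×ˢ Set.Icc 0 1) := by
    rintro ⟨⟨x, s⟩, ⟨hx, hs⟩, h⟩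
    exact hne x (ne_zero_of_mem_l1Sphere hx) s hs h
  obtain ⟨r, hr, hball⟩ := Metric.isOpen_iff.1 hK.isClosed.isOpen_compl 0 h0
  have hn : (0 : ℝ) < n + 1 := by positivity
  obtain ⟨δ, hδ, hD⟩ :=
    exists_boundary_eq_of_homotopy (isCompact_l1Sphere n n) hH (div_pos hr hn)
  obtain ⟨z, hz, hz0, hz1⟩ := exists_hemisphere_chain n n le_rfl hδ
  have hc : z + map (fun x => -x) z ∈ small (l1Sphere n n) δ :=
    add_mem hz (map_mem_small (fun x hx => neg_mem_l1Sphere hx)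
      (fun x _ y _ h => by rwa [dist_neg_neg]) hz)
  obtain ⟨D, hDs, hbD⟩ := hD _ hc hz0
  have hbD' : boundary D = z + map (fun x => -x) z := by
    have h1 : (fun x => H (x, 0)) = fun x => x := by ext1; simp [hHdef]
    have h2 : (fun x => H (x, 1)) = G := by ext1; simp [hHdef]
    have h3 : G ∘ (fun x => -x) = G := funext heven
    rw [hbD, h1, h2, map_fun_id, map_add (map G), map_map, h3, ZModModule.add_self, add_zero]
  choose θ hθodd hθpos hθneg using exists_odd_sign (n := n)
  have hcup : cup (List.ofFn θ) D = 1 := by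
    rw [List.ofFn_succ, cup_cons, hbD', mulCup_add_map (s := {x | x ≠ 0})]
    · refine hz1 _ (by simp) fun θ' hθ' => ?_
      obtain ⟨i, rfl⟩ := (List.mem_ofFn' _ _).1 hθ'
      exact hθodd _
    · rw [← List.ofFn_succ]
      intro θ' hθ'
      obtain ⟨i, rfl⟩ := (List.mem_ofFn' _ _).1 hθ'
      exact hθodd i
    · exact small_le_supported (fun x hx => ne_zero_of_mem_l1Sphere hx) _ hz
  obtain ⟨l, hl, hl0⟩ : ∃ l : List (EuclideanSpace ℝ (Fin (n + 1))),
      ((∀ x ∈ l, x ∈ H '' (l1Sphere n n ×ˢ Set.Icc 0 1)) ∧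
        ∀ x ∈ l, ∀ y ∈ l, dist x y < r / (n + 1)) ∧ cupTuple (List.ofFn θ) l ≠ 0 := by
    by_contra! hall
    have : cup (List.ofFn θ) D = 0 :=
      eq_of_supported (T := 0) (fun l hl => by simpa using hall l hl) hDs
    exact one_ne_zero (hcup.symm.trans this)
  have hsign (i : Fin (n + 1)) : ∃ x ∈ l, ∃ y ∈ l, 0 ≤ x i ∧ y i ≤ 0 := by
    obtain ⟨x, hx, y, hy, hxy⟩ :=
      exists_ne_of_cupTuple_ne_zero hl0 ((List.mem_ofFn' _ _).2 ⟨i, rfl⟩)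
    rcases lt_or_ge (x i) 0 with h | h <;> rcases lt_or_ge (y i) 0 with h' | h'
    · exact absurd ((hθneg i x h).trans (hθneg i y h').symm) hxy
    · exact ⟨y, hy, x, hx, h', h.le⟩
    · exact ⟨x, hx, y, hy, h, h'.le⟩
    · rcases h.eq_or_lt with h0 | h
      · exact ⟨y, hy, x, hx, h', h0.symm.le⟩
      · rcases h'.eq_or_lt with h0' | h'
        · exact ⟨x, hx, y, hy, h.le, h0'.symm.le⟩
        · exact absurd ((hθpos i x h).trans (hθpos i y h').symm) hxy
  obtain ⟨w, hw, -⟩ := hsign 0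
  have hcoord (i : Fin (n + 1)) : |w i| < r / (n + 1) := by
    obtain ⟨x, hx, y, hy, hxi, hyi⟩ := hsign i
    have hdist (v : EuclideanSpace ℝ (Fin (n + 1))) (hv : v ∈ l) :
        |w i - v i| < r / (n + 1) := by
      refine lt_of_le_of_lt ?_ (hl.2 w hw v hv)
      simpa [dist_eq_norm] using PiLp.norm_apply_le (w - v) i
    have h1 := abs_lt.1 (hdist x hx)
    have h2 := abs_lt.1 (hdist y hy)
    exact abs_lt.2 ⟨by linarith, by linarith⟩
  refine hball ?_ (hl.1 w hw)
  rw [mem_ball_zero_iff]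
  calc ‖w‖ ≤ ∑ i, |w i| := norm_le_sum_abs w
    _ < ∑ _i : Fin (n + 1), r / (n + 1) :=
      Finset.sum_lt_sum_of_nonempty Finset.univ_nonempty fun i _ => hcoord i
    _ = r := by
      simp only [Finset.sum_const, Finset.card_univ, Fintype.card_fin, nsmul_eq_mul]
      push_cast
      field_simp

end Sphere

/-- A continuous self-map of the unit sphere `S ⊆ ℝ^{n+1}` which agrees on antipodal
points (`f (-x) = f x`) has a fixed point. -/
theorem stmt11 (n : ℕ)
    (f : Metric.sphere (0 : EuclideanSpace ℝ (Fin (n + 1))) 1 →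
      Metric.sphere (0 : EuclideanSpace ℝ (Fin (n + 1))) 1)
    (hf : Continuous f) (hodd : ∀ x, f (-x) = f x) :
    ∃ x, f x = x := by
  classical
  have hunit (x : EuclideanSpace ℝ (Fin (n + 1))) (hx : x ≠ 0) :
      ‖x‖⁻¹ • x ∈ Metric.sphere (0 : EuclideanSpace ℝ (Fin (n + 1))) 1 := by
    rw [mem_sphere_zero_iff_norm, norm_smul, norm_inv, norm_norm,
      inv_mul_cancel₀ (norm_ne_zero_iff.2 hx)]
  let G : EuclideanSpace ℝ (Fin (n + 1)) → EuclideanSpace ℝ (Fin (n + 1)) := fun x =>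
    if hx : x ≠ 0 then -(f ⟨‖x‖⁻¹ • x, hunit x hx⟩ : EuclideanSpace ℝ (Fin (n + 1))) else 0
  have hGne (x : EuclideanSpace ℝ (Fin (n + 1))) (hx : x ≠ 0) :
      G x = -(f ⟨‖x‖⁻¹ • x, hunit x hx⟩ : EuclideanSpace ℝ (Fin (n + 1))) := dif_pos hx
  have hGcont : ContinuousOn G {x | x ≠ 0} := by
    rw [continuousOn_iff_continuous_domRestrict]
    have hval : Continuous fun x : {x : EuclideanSpace ℝ (Fin (n + 1)) // x ≠ 0} =>
        ‖x.1‖⁻¹ • x.1 :=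
      (Continuous.inv₀ (by fun_prop) fun x => norm_ne_zero_iff.2 x.2).smul
        continuous_subtype_val
    have hcont : Continuous fun x : {x : EuclideanSpace ℝ (Fin (n + 1)) // x ≠ 0} =>
        -(f ⟨‖x.1‖⁻¹ • x.1, hunit x.1 x.2⟩ : EuclideanSpace ℝ (Fin (n + 1))) :=
      (continuous_subtype_val.comp (hf.comp (hval.subtype_mk _))).neg
    exact hcont.congr fun x => (hGne x.1 x.2).symm
  have hGeven (x : EuclideanSpace ℝ (Fin (n + 1))) : G (-x) = G x := by
    by_cases hx : x = 0
    · rw [hx, neg_zero]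
    · rw [hGne x hx, hGne (-x) (neg_ne_zero.2 hx), ← hodd]
      congr 3
      ext1
      simp
  obtain ⟨x, hx, s, hs, h⟩ := exists_segment_eq_zero_of_even hGcont hGeven
  set u : Metric.sphere (0 : EuclideanSpace ℝ (Fin (n + 1))) 1 := ⟨‖x‖⁻¹ • x, hunit x hx⟩
    with hu
  have hxu : x = ‖x‖ • (u : EuclideanSpace ℝ (Fin (n + 1))) := by
    rw [hu, smul_smul, mul_inv_cancel₀ (norm_ne_zero_iff.2 hx), one_smul]
  have hx0 : 0 < ‖x‖ := norm_pos_iff.2 hx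
  have h' : (1 - s) • x = s • (f u : EuclideanSpace ℝ (Fin (n + 1))) := by
    rw [hGne x hx, smul_neg] at h
    exact sub_eq_zero.1 (by rwa [sub_eq_add_neg])
  have hnorm : (1 - s) * ‖x‖ = s := by
    have := congrArg norm h'
    rwa [norm_smul, norm_smul, norm_eq_of_mem_sphere, mul_one, Real.norm_of_nonneg hs.1,
      Real.norm_of_nonneg (sub_nonneg.2 hs.2)] at this
  have hs0 : s ≠ 0 := by
    rintro rfl
    simp [hx] at hnorm
  refine ⟨u, Subtype.ext (smul_right_injective _ hs0 ?_)⟩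
  change s • (f u : EuclideanSpace ℝ (Fin (n + 1))) = s • (u : EuclideanSpace ℝ (Fin (n + 1)))
  rw [← h']
  nth_rewrite 1 [hxu]
  rw [smul_smul, hnorm]
end

section
/- Let n be a natural number, let E = ℝ^{n+1} be Euclidean space, let B : E → E → E be a symmetric bilinear map, and define the homogeneous quadratic map Q by Q(x) = B(x, x). Suppose Q(x) ≠ 0 for every nonzero x in E. Then there exist a vector v in E with ‖v‖ = 1 and a real number c > 0 such that Q(v) = c • v. That is, Q keeps a line through the origin invariant. -/
open Module MvPolynomial

theorem exists_least_square_factor {N : ℕ} (k : ℕ) (m : Fin N →₀ ℕ) :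
    (∀ i : Fin N, i.val < k → m i ≤ 1) ∨
      ∃ (i : Fin N) (u : Fin N →₀ ℕ), i.val < k ∧ (∀ j < i, u j ≤ 1) ∧
        m = u + Finsupp.single i 2 := by
  by_cases h : ∃ i : Fin N, i.val < k ∧ 2 ≤ m i
  · right
    obtain ⟨i, ⟨hik, hi⟩, hmin⟩ :=
      wellFounded_lt.has_min {i : Fin N | i.val < k ∧ 2 ≤ m i} h
    refine ⟨i, m - Finsupp.single i 2, hik, fun j hj => ?_, ?_⟩
    · by_contra! hmj
      refine hmin j ⟨lt_trans hj hik, ?_⟩ hj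
      exact le_trans hmj (by simp)
    · ext j
      by_cases hj : i = j
      · subst hj
        simp [hi]
      · simp [hj]
  · left
    grind

theorem least_square_factor_unique {N : ℕ} {i j : Fin N} {u v : Fin N →₀ ℕ}
    (hu : ∀ l < i, u l ≤ 1) (hv : ∀ l < j, v l ≤ 1)
    (h : u + Finsupp.single i 2 = v + Finsupp.single j 2) : i = j ∧ u = v := by
  have hij : i = j := by
    by_contra hne
    have h1 := DFunLike.congr_fun h i
    have h2 := DFunLike.congr_fun h j
    simp only [Finsupp.add_apply, Finsupp.single_apply, if_true, if_neg hne,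
      if_neg (Ne.symm hne)] at h1 h2
    rcases lt_or_gt_of_ne hne with hlt | hlt
    · have := hv i hlt
      lia
    · have := hu j hlt
      lia
  subst hij
  exact ⟨rfl, add_right_cancel h⟩

/-- The linear map replacing the first square `X i ^ 2` (with `i < k`) in a monomial by `h i`,
and killing the monomials without such a square. -/
theorem exists_square_replacement {N : ℕ} (h : Fin N → MvPolynomial (Fin N) ℝ) (k : ℕ) :
    ∃ A : End ℝ (MvPolynomial (Fin N) ℝ),
      (∀ m : Fin N →₀ ℕ, (∀ i : Fin N, i.val < k → m i ≤ 1) → A (monomial m 1) = 0) ∧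
      ∀ (i : Fin N) (u : Fin N →₀ ℕ), i.val < k → (∀ j < i, u j ≤ 1) →
        A (monomial (u + Finsupp.single i 2) 1) = h i * monomial u 1 := by
  have hw (m : Fin N →₀ ℕ) : ∃ w : MvPolynomial (Fin N) ℝ,
      ((∀ i : Fin N, i.val < k → m i ≤ 1) → w = 0) ∧
      ∀ (i : Fin N) (u : Fin N →₀ ℕ), i.val < k → (∀ j < i, u j ≤ 1) →
        m = u + Finsupp.single i 2 → w = h i * monomial u 1 := by
    rcases exists_least_square_factor k m with hm | ⟨i, u, hik, hu, rfl⟩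
    · refine ⟨0, fun _ => rfl, ?_⟩
      rintro i u hik - rfl
      simpa using hm i hik
    · refine ⟨h i * monomial u 1, fun hm => by simpa using hm i hik, ?_⟩
      intro j v _ hv huv
      obtain ⟨rfl, rfl⟩ := least_square_factor_unique hu hv huv
      rfl
  choose w hw0 hw1 using hw
  have hA (m) : (basisMonomials (Fin N) ℝ).constr ℝ w (monomial m 1) = w m := by
    simpa using (basisMonomials (Fin N) ℝ).constr_basis ℝ w m
  refine ⟨(basisMonomials (Fin N) ℝ).constr ℝ w, fun m hm => ?_, fun i u hik hu => ?_⟩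
  · rw [hA, hw0 m hm]
  · rw [hA, hw1 _ i u hik hu rfl]

theorem square_replacement_mem_restrictTotalDegree {N : ℕ} {h : Fin N → MvPolynomial (Fin N) ℝ}
    (hdeg : ∀ i, (h i).totalDegree ≤ 2) {k : ℕ} {A : End ℝ (MvPolynomial (Fin N) ℝ)}
    (hA0 : ∀ m : Fin N →₀ ℕ, (∀ i : Fin N, i.val < k → m i ≤ 1) → A (monomial m 1) = 0)
    (hA1 : ∀ (i : Fin N) (u : Fin N →₀ ℕ), i.val < k → (∀ j < i, u j ≤ 1) →
        A (monomial (u + Finsupp.single i 2) 1) = h i * monomial u 1)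
    (D : ℕ) {p : MvPolynomial (Fin N) ℝ} (hp : p ∈ restrictTotalDegree (Fin N) ℝ D) :
    A p ∈ restrictTotalDegree (Fin N) ℝ D := by
  rw [restrictTotalDegree, restrictSupport_eq_span] at hp
  induction hp using Submodule.span_induction with
  | mem x hx =>
    obtain ⟨m, hm, rfl⟩ := hx
    dsimp only
    rcases exists_least_square_factor k m with hm' | ⟨i, u, hik, hu, rfl⟩
    · rw [hA0 m hm']
      exact zero_mem _
    · rw [hA1 i u hik hu, mem_restrictTotalDegree]
      refine (totalDegree_mul _ _).trans ?_
      rw [totalDegree_monomial _ one_ne_zero]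
      have := hdeg i
      rw [Set.mem_ofPred_eq, Finsupp.sum_add_index' (by simp) (by simp)] at hm
      simp only [Finsupp.sum_single_index] at hm
      lia
  | zero => simp
  | add x y _ _ hx hy => rw [map_add]; exact add_mem hx hy
  | smul a x _ hx => rw [map_smul]; exact Submodule.smul_mem _ _ hx

/-- An injective endomorphism of a union of finite-dimensional invariant subspaces is
surjective. -/
theorem surjective_of_injective_of_locally_finite {K V : Type*} [Field K] [AddCommGroup V]
    [Module K V] {T : End K V} (hT : Function.Injective T) (W : ℕ → Submodule K V)
    [∀ D, FiniteDimensional K (W D)] (hW : ∀ D, ∀ p ∈ W D, T p ∈ W D)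
    (hcover : ∀ p, ∃ D, p ∈ W D) : Function.Surjective T := by
  intro p
  obtain ⟨D, hD⟩ := hcover p
  have hinj : Function.Injective (T.restrict (hW D)) := fun x y hxy =>
    Subtype.ext (hT (by simpa using congrArg Subtype.val hxy))
  obtain ⟨q, hq⟩ := LinearMap.injective_iff_surjective.mp hinj ⟨p, hD⟩
  exact ⟨q, by simpa using congrArg Subtype.val hq⟩

theorem countable_eigenvalues_of_locally_finite {K V : Type*} [Field K] [AddCommGroup V]
    [Module K V] (T : End K V) (W : ℕ → Submodule K V)
    [∀ D, FiniteDimensional K (W D)] (hW : ∀ D, ∀ p ∈ W D, T p ∈ W D)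
    (hcover : ∀ p, ∃ D, p ∈ W D) : {μ | T.HasEigenvalue μ}.Countable := by
  refine (Set.countable_iUnion fun D =>
    (End.finite_hasEigenvalue (T.restrict (hW D))).countable).mono fun μ hμ => ?_
  obtain ⟨v, hv⟩ := End.HasEigenvalue.exists_hasEigenvector hμ
  obtain ⟨D, hD⟩ := hcover v
  refine Set.mem_iUnion.mpr ⟨D, End.hasEigenvalue_of_hasEigenvector (x := ⟨v, hD⟩) ⟨?_, ?_⟩⟩
  · rw [End.mem_eigenspace_iff]
    exact Subtype.ext (by simpa using hv.apply_eq_smul)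
  · simpa [Subtype.ext_iff] using hv.2

/-- For all but countably many `s`, the squarefree monomials form a basis of the quotient by the
ideal generated by the `s * X i ^ 2 + h i`. -/
theorem countable_not_isCompl_squarefree {N : ℕ} {h : Fin N → MvPolynomial (Fin N) ℝ}
    (hdeg : ∀ i, (h i).totalDegree ≤ 2) :
    {s : ℝ | ¬ IsCompl (restrictSupport ℝ {m : Fin N →₀ ℕ | ∀ i, m i ≤ 1})
      ((Ideal.span (Set.range fun i => C s * X i ^ 2 + h i)).restrictScalars ℝ)}.Countable := by
  choose A hA0 hA1 using exists_square_replacement h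
  have hAW (k D : ℕ) (p) (hp : p ∈ restrictTotalDegree (Fin N) ℝ D) :
      A k p ∈ restrictTotalDegree (Fin N) ℝ D :=
    square_replacement_mem_restrictTotalDegree hdeg (hA0 k) (hA1 k) D hp
  have hcover (p : MvPolynomial (Fin N) ℝ) : ∃ D, p ∈ restrictTotalDegree (Fin N) ℝ D :=
    ⟨p.totalDegree, (mem_restrictTotalDegree _ _ _).mpr le_rfl⟩
  have hcount : (⋃ k, {s : ℝ | (A k).HasEigenvalue (-s)}).Countable := by
    refine Set.countable_iUnion fun k => ?_
    exact (countable_eigenvalues_of_locally_finite (A k) _ (hAW k) hcover).preimage neg_injective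
  refine (hcount.union (Set.countable_singleton 0)).mono fun s hs => ?_
  by_contra hgood
  apply hs
  simp only [Set.mem_union, Set.mem_iUnion, Set.mem_ofPred_eq, Set.mem_singleton_iff, not_or,
    not_exists] at hgood
  obtain ⟨heig, hs0⟩ := hgood
  set f : Fin N → MvPolynomial (Fin N) ℝ := fun i => C s * X i ^ 2 + h i with hf
  let T (k : ℕ) : End ℝ (MvPolynomial (Fin N) ℝ) := s • 1 + A k
  have hT (k p) : T k p = s • p + A k p := rfl
  have hT0 (k : ℕ) (m : Fin N →₀ ℕ) (hm : ∀ i : Fin N, i.val < k → m i ≤ 1) :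
      T k (monomial m 1) = s • monomial m 1 := by rw [hT, hA0 k m hm, add_zero]
  have hT1 (k : ℕ) (i : Fin N) (u : Fin N →₀ ℕ) (hi : i.val < k) (hu : ∀ j < i, u j ≤ 1) :
      T k (monomial (u + Finsupp.single i 2) 1) = f i * monomial u 1 := by
    rw [hT, hA1 k i u hi hu, hf, add_mul, smul_eq_C_mul, mul_assoc]
    congr 2
    rw [X_pow_eq_monomial, monomial_mul, add_comm, one_mul]
  have hTinj (k : ℕ) : Function.Injective (T k) := by
    rw [injective_iff_map_eq_zero]
    intro p hp
    by_contra hp0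
    refine heig k (End.hasEigenvalue_of_hasEigenvector (x := p) ⟨?_, hp0⟩)
    rw [End.mem_eigenspace_iff, neg_smul]
    exact eq_neg_of_add_eq_zero_right hp
  have hTsurj (k : ℕ) : Function.Surjective (T k) :=
    surjective_of_injective_of_locally_finite (hTinj k) (restrictTotalDegree (Fin N) ℝ)
      (fun D p hp => add_mem (Submodule.smul_mem _ _ hp) (hAW k D p hp)) hcover
  let H (k : ℕ) : Submodule ℝ (MvPolynomial (Fin N) ℝ) :=
    restrictSupport ℝ {m | ∀ i : Fin N, i.val < k → m i ≤ 1}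
  let J (k : ℕ) : Submodule ℝ (MvPolynomial (Fin N) ℝ) :=
    Submodule.span ℝ {q | ∃ (i : Fin N) (u : Fin N →₀ ℕ), i.val < k ∧ (∀ j < i, u j ≤ 1) ∧
      q = f i * monomial u 1}
  have hJmono {k l : ℕ} (hkl : k ≤ l) : J k ≤ J l :=
    Submodule.span_mono fun q ⟨i, u, hi, hu, hq⟩ => ⟨i, u, hi.trans_le hkl, hu, hq⟩
  have hHJ (k : ℕ) (p) : p ∈ H k ⊔ J k := by
    obtain ⟨q, rfl⟩ := hTsurj k p
    induction q using MvPolynomial.induction_on' with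
    | monomial m a =>
      have : monomial m a = a • monomial m (1 : ℝ) := by simp [smul_monomial]
      rw [this, map_smul]
      refine Submodule.smul_mem _ _ ?_
      rcases exists_least_square_factor k m with hm | ⟨i, u, hi, hu, rfl⟩
      · rw [hT0 k m hm]
        refine Submodule.mem_sup_left (Submodule.smul_mem _ _ ?_)
        exact (monomial_mem_restrictSupport ℝ).mpr (Or.inl hm)
      · rw [hT1 k i u hi hu]
        exact Submodule.mem_sup_right (Submodule.subset_span ⟨i, u, hi, hu, rfl⟩)
    | add p q hp hq => rw [map_add]; exact add_mem hp hq
  have hfJ (k : ℕ) : ∀ i : Fin N, i.val = k → ∀ p, f i * p ∈ J (k + 1) := by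
    induction k using Nat.strong_induction_on with
    | _ k ih =>
    rintro i rfl p
    obtain ⟨a, ha, b, hb, rfl⟩ := Submodule.mem_sup.mp (hHJ i.val p)
    rw [mul_add]
    refine add_mem ?_ ?_
    · simp only [H, restrictSupport_eq_span] at ha
      induction ha using Submodule.span_induction with
      | mem x hx =>
        obtain ⟨m, hm, rfl⟩ := hx
        exact Submodule.subset_span ⟨i, m, i.val.lt_succ_self, fun j hj => hm j hj, rfl⟩
      | zero => simp
      | add x y _ _ hx hy => rw [mul_add]; exact add_mem hx hy
      | smul a x _ hx => rw [mul_smul_comm]; exact Submodule.smul_mem _ _ hx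
    · induction hb using Submodule.span_induction with
      | mem x hx =>
        obtain ⟨j, u, hj, -, rfl⟩ := hx
        rw [mul_left_comm]
        exact hJmono (by lia) (ih j.val hj j rfl _)
      | zero => simp
      | add x y _ _ hx hy => rw [mul_add]; exact add_mem hx hy
      | smul a x _ hx => rw [mul_smul_comm]; exact Submodule.smul_mem _ _ hx
  have hIJ : (Ideal.span (Set.range f)).restrictScalars ℝ = J N := by
    refine le_antisymm (fun p hp => ?_) (Submodule.span_le.mpr ?_)
    · obtain ⟨c, rfl⟩ := Ideal.mem_span_range_iff_exists_fun.mp hp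
      refine sum_mem fun i _ => ?_
      rw [mul_comm]
      exact hJmono i.isLt (hfJ i.val i rfl _)
    · rintro _ ⟨i, u, -, -, rfl⟩
      exact Ideal.mul_mem_right _ _ (Ideal.subset_span ⟨i, rfl⟩)
  have hHN : restrictSupport ℝ {m : Fin N →₀ ℕ | ∀ i, m i ≤ 1} = H N := by
    simp [H]
  have hTH : ∀ p ∈ H N, T N p = s • p := by
    intro p hp
    simp only [H, restrictSupport_eq_span] at hp
    induction hp using Submodule.span_induction with
    | mem x hx =>
      obtain ⟨m, hm, rfl⟩ := hx
      exact hT0 N m hm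
    | zero => simp
    | add x y _ _ hx hy => rw [map_add, smul_add, hx, hy]
    | smul a x _ hx => rw [map_smul, hx, smul_comm]
  rw [hIJ, hHN]
  refine ⟨Submodule.disjoint_def.mpr fun p hpH hpJ => ?_,
    codisjoint_iff.mpr (Submodule.eq_top_iff'.mpr (hHJ N))⟩
  have hJT : J N ≤ (restrictSupport ℝ {m : Fin N →₀ ℕ | ∃ i, 2 ≤ m i}).map (T N) := by
    refine Submodule.span_le.mpr ?_
    rintro _ ⟨i, u, hi, hu, rfl⟩
    refine ⟨monomial (u + Finsupp.single i 2) 1, ?_, hT1 N i u hi hu⟩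
    exact (monomial_mem_restrictSupport ℝ).mpr (Or.inl ⟨i, by simp⟩)
  obtain ⟨q, hq, hqp⟩ := hJT hpJ
  have hpq : p = s • q := hTinj N (by rw [hTH p hpH, map_smul, hqp])
  have hpsq : p ∈ restrictSupport ℝ {m : Fin N →₀ ℕ | ∃ i, 2 ≤ m i} :=
    hpq ▸ Submodule.smul_mem _ _ hq
  rw [mem_restrictSupport_iff] at hpsq
  rw [← MvPolynomial.support_eq_empty, Finset.eq_empty_iff_forall_notMem]
  intro m hm
  obtain ⟨i, hi⟩ := hpsq hm
  have := (mem_restrictSupport_iff ℝ).mp hpH hm i i.isLt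
  lia

/-- A real endomorphism of an odd-dimensional space has a real eigenvalue. -/
theorem exists_hasEigenvalue_of_odd_finrank {V : Type*} [AddCommGroup V] [Module ℝ V]
    [FiniteDimensional ℝ V] (h : Odd (finrank ℝ V)) (T : End ℝ V) : ∃ μ : ℝ, T.HasEigenvalue μ := by
  have hd : Odd T.charpoly.natDegree := by rwa [LinearMap.charpoly_natDegree]
  have hroot : ∃ x, T.charpoly.IsRoot x := by
    refine Continuous.surjective T.charpoly.continuous ?_ ?_ 0
    · refine T.charpoly.tendsto_atTop_of_leadingCoeff_nonneg ?_ ?_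
      · exact Polynomial.natDegree_pos_iff_degree_pos.mp hd.pos
      · simp [T.charpoly_monic.leadingCoeff]
    · have hlead : (T.charpoly.comp (-Polynomial.X)).leadingCoeff = -1 := by
        rw [Polynomial.leadingCoeff_comp (by simp)]
        simp [T.charpoly_monic.leadingCoeff, hd.neg_one_pow]
      have hdeg : (T.charpoly.comp (-Polynomial.X)).natDegree = T.charpoly.natDegree := by
        simp [Polynomial.natDegree_comp]
      have := (T.charpoly.comp (-Polynomial.X)).tendsto_atBot_of_leadingCoeff_nonpos
        (Polynomial.natDegree_pos_iff_degree_pos.mp (hdeg ▸ hd.pos)) (by simp [hlead])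
      simpa [Function.comp_def] using this.comp Filter.tendsto_neg_atBot_atTop
  obtain ⟨x, hx⟩ := hroot
  exact ⟨x, (End.hasEigenvalue_iff_isRoot_charpoly T x).mpr hx⟩

/-- Commuting operators on an odd-dimensional real space have a common eigenvector. -/
theorem exists_common_eigenvector_of_odd_finrank {R : Type*} [CommRing R] [Algebra ℝ R] (d : ℕ) :
    ∀ (V : Type*) [AddCommGroup V] [Module ℝ V] [Module R V] [IsScalarTower ℝ R V]
      [FiniteDimensional ℝ V], finrank ℝ V = d → Odd d →
      ∃ v : V, v ≠ 0 ∧ ∀ r : R, ∃ c : ℝ, r • v = c • v := by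
  induction d using Nat.strong_induction_on with
  | _ d ih =>
  intro V _ _ _ _ _ hd hodd
  by_cases hall : ∀ r : R, ∃ c : ℝ, ∀ v : V, r • v = c • v
  · have : 0 < finrank ℝ V := hd ▸ hodd.pos
    have : Nontrivial V := finrank_pos_iff.mp this
    obtain ⟨v, hv⟩ := exists_ne (0 : V)
    exact ⟨v, hv, fun r => (hall r).imp fun c hc => hc v⟩
  push Not at hall
  obtain ⟨r, hr⟩ := hall
  obtain ⟨μ, hμ⟩ := exists_hasEigenvalue_of_odd_finrank (hd ▸ hodd) (Algebra.lsmul ℝ ℝ V r)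
  let T : V →ₗ[R] V := LinearMap.lsmul R V (r - algebraMap ℝ R μ)
  have hT (v : V) : T v = r • v - μ • v := by simp [T]
  have hfin (W : Submodule R V) : FiniteDimensional ℝ W :=
    FiniteDimensional.of_injective (W.subtype.restrictScalars ℝ) W.injective_subtype
  have hsum : finrank ℝ (LinearMap.range T) + finrank ℝ (LinearMap.ker T) = d := by
    rw [← hd]
    exact (T.restrictScalars ℝ).finrank_range_add_finrank_ker
  have hker : 0 < finrank ℝ (LinearMap.ker T) := by
    obtain ⟨v, hv⟩ := hμ.exists_hasEigenvector
    have : Nontrivial (LinearMap.ker T) := by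
      refine ⟨⟨⟨v, ?_⟩, 0, ?_⟩⟩
      · rw [LinearMap.mem_ker, hT, sub_eq_zero]
        exact hv.apply_eq_smul
      · simpa [Subtype.ext_iff] using hv.2
    exact finrank_pos
  have hrange : 0 < finrank ℝ (LinearMap.range T) := by
    obtain ⟨v, hv⟩ := hr μ
    have : Nontrivial (LinearMap.range T) := by
      refine ⟨⟨⟨T v, v, rfl⟩, 0, ?_⟩⟩
      simpa [Subtype.ext_iff, hT, sub_eq_zero] using hv
    exact finrank_pos
  have key (W : Submodule R V) (hW : finrank ℝ W < d) (hWodd : Odd (finrank ℝ W)) :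
      ∃ v : V, v ≠ 0 ∧ ∀ r : R, ∃ c : ℝ, r • v = c • v := by
    obtain ⟨v, hv, h⟩ := ih _ hW W rfl hWodd
    refine ⟨v, by simpa using hv, fun r => (h r).imp fun c hc => ?_⟩
    simpa using congrArg Subtype.val hc
  by_cases ho : Odd (finrank ℝ (LinearMap.ker T))
  · exact key _ (by lia) ho
  · refine key (LinearMap.range T) (by lia) ?_
    grind

theorem even_card_squarefree_exponents {N : ℕ} (hN : 0 < N) :
    Even (Nat.card {m : Fin N →₀ ℕ | ∀ i, m i ≤ 1}) := by
  let e : {m : Fin N →₀ ℕ | ∀ i, m i ≤ 1} ≃ (Fin N → Fin 2) :=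
    { toFun := fun m i => ⟨m.1 i, Nat.lt_succ_of_le (m.2 i)⟩
      invFun := fun u => ⟨Finsupp.equivFunOnFinite.symm fun i => (u i).val,
        fun i => Nat.le_of_lt_succ (u i).isLt⟩
      left_inv := fun m => by ext i; simp
      right_inv := fun u => by ext i; simp }
  rw [Nat.card_congr e, Nat.card_eq_fintype_card]
  simp [Nat.even_pow, hN.ne']

/-- A nonzero real solution of `s x² + g(x) = x`, where `g` is given by quadratic forms, for all
but countably many `s`. -/
theorem countable_not_exists_quadratic_fixed_point {N : ℕ} (hN : 0 < N)
    (b : Fin N → Fin N → Fin N → ℝ) :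
    {s : ℝ | ¬ ∃ x : Fin N → ℝ, x ≠ 0 ∧
      ∀ i, s * x i ^ 2 + ∑ j, ∑ k, b i j k * (x j * x k) = x i}.Countable := by
  let g (i : Fin N) : MvPolynomial (Fin N) ℝ := ∑ j, ∑ k, C (b i j k) * (X j * X k)
  have hdeg (i : Fin N) : (g i - X i).totalDegree ≤ 2 := by
    refine (totalDegree_sub _ _).trans (max_le ?_ (by simp))
    refine totalDegree_finsetSum_le fun j _ => totalDegree_finsetSum_le fun k _ => ?_
    refine (totalDegree_mul _ _).trans ?_
    rw [totalDegree_C, zero_add]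
    exact (totalDegree_mul _ _).trans (by simp)
  refine (countable_not_isCompl_squarefree hdeg).mono fun s hs => ?_
  intro hcompl
  apply hs
  set f : Fin N → MvPolynomial (Fin N) ℝ := fun i => C s * X i ^ 2 + (g i - X i) with hf
  set I := Ideal.span (Set.range f)
  let A := MvPolynomial (Fin N) ℝ ⧸ I
  let S : Submodule ℝ (MvPolynomial (Fin N) ℝ) := restrictSupport ℝ {m | ∀ i, m i ≤ 1}
  have hcard := even_card_squarefree_exponents hN
  have hfinite : Finite {m : Fin N →₀ ℕ | ∀ i, m i ≤ 1} := by
    refine Finite.of_injective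
      (fun m i => (⟨m.1 i, Nat.lt_succ_of_le (m.2 i)⟩ : Fin 2) : _ → (Fin N → Fin 2)) ?_
    intro m m' h
    ext i
    simpa using congrFun h i
  have hSfin : Module.Finite ℝ S := Module.Finite.of_basis (basisRestrictSupport ℝ _)
  let E : A ≃ₗ[ℝ] S := Submodule.quotientEquivOfIsCompl (I.restrictScalars ℝ) S hcompl.symm
  have hAfin : FiniteDimensional ℝ A := Module.Finite.equiv E.symm
  have hA : Even (finrank ℝ A) := by
    rw [E.finrank_eq, Module.finrank_eq_nat_card_basis (basisRestrictSupport ℝ _)]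
    exact hcard
  have hIε : ∀ p ∈ I, aeval (0 : Fin N → ℝ) p = 0 := by
    intro p hp
    change p ∈ RingHom.ker (aeval (0 : Fin N → ℝ))
    refine Ideal.span_le.mpr ?_ hp
    rintro _ ⟨i, rfl⟩
    simp [hf, g]
  let ε : A →ₐ[ℝ] ℝ := Ideal.Quotient.liftₐ I (aeval 0) hIε
  let K : Ideal A := RingHom.ker ε
  have hK : Odd (finrank ℝ K) := by
    have h1 := ε.toLinearMap.finrank_range_add_finrank_ker
    have h2 : LinearMap.range ε.toLinearMap = ⊤ := LinearMap.range_eq_top.mpr fun r =>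
      ⟨algebraMap ℝ A r, by simp⟩
    rw [h2, finrank_top, finrank_self] at h1
    have h3 : finrank ℝ K = finrank ℝ (LinearMap.ker ε.toLinearMap) := rfl
    rw [h3]
    exact Nat.not_even_iff_odd.mp (Nat.even_add_one.mp (by rwa [add_comm, h1]))
  have hKfin : FiniteDimensional ℝ K :=
    FiniteDimensional.of_injective (K.subtype.restrictScalars ℝ) K.injective_subtype
  obtain ⟨⟨v, hvK⟩, hv0, hv⟩ := exists_common_eigenvector_of_odd_finrank (R := A) _ K rfl hK
  choose χ hχ using hv
  replace hv0 : v ≠ 0 := by simpa using hv0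
  replace hχ (r : A) : r * v = χ r • v := by simpa using congrArg Subtype.val (hχ r)
  let mk : MvPolynomial (Fin N) ℝ →ₐ[ℝ] A := Ideal.Quotient.mkₐ ℝ I
  let x : Fin N → ℝ := fun i => χ (mk (X i))
  have hp (p : MvPolynomial (Fin N) ℝ) : mk p * v = aeval x p • v := by
    induction p using MvPolynomial.induction_on with
    | C a =>
      rw [← MvPolynomial.algebraMap_eq, AlgHom.commutes, AlgHom.commutes, ← Algebra.smul_def]
      rfl
    | add p q hp hq => rw [map_add, map_add, add_mul, add_smul, hp, hq]
    | mul_X p i hp =>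
      rw [map_mul, map_mul, mul_assoc, hχ, mul_smul_comm, hp, smul_smul, aeval_X, mul_comm]
  have hmkf (i : Fin N) : mk (f i) = 0 :=
    Ideal.Quotient.eq_zero_iff_mem.mpr (Ideal.subset_span ⟨i, rfl⟩)
  refine ⟨x, fun hx => ?_, fun i => ?_⟩
  · have hXK (i : Fin N) : mk (X i) ∈ K := by
      change aeval (0 : Fin N → ℝ) (X i : MvPolynomial (Fin N) ℝ) = 0
      simp
    have hXK2 (i : Fin N) : mk (X i) ∈ K * K := by
      have : mk (X i) = mk (C s * X i ^ 2 + g i) := by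
        rw [eq_comm, ← sub_eq_zero, ← map_sub, ← hmkf i, hf]
        congr 1
        ring
      rw [this]
      simp only [g, map_add, map_mul, map_sum, pow_two]
      refine add_mem (Ideal.mul_mem_left _ _ (Ideal.mul_mem_mul (hXK i) (hXK i))) ?_
      refine sum_mem fun j _ => sum_mem fun k _ => ?_
      exact Ideal.mul_mem_left _ _ (Ideal.mul_mem_mul (hXK j) (hXK k))
    have hmkK (p : MvPolynomial (Fin N) ℝ) :
        mk p - algebraMap ℝ A (aeval (0 : Fin N → ℝ) p) ∈ K * K := by
      induction p using MvPolynomial.induction_on with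
      | C a =>
        rw [← MvPolynomial.algebraMap_eq, AlgHom.commutes, AlgHom.commutes]
        simp
      | add p q hp hq =>
        rw [map_add, map_add, map_add, add_sub_add_comm]
        exact add_mem hp hq
      | mul_X p i hp =>
        rw [map_mul, map_mul, aeval_X, Pi.zero_apply, mul_zero, map_zero, sub_zero]
        exact Ideal.mul_mem_left _ _ (hXK2 i)
    have hKK : K ≤ K • K := by
      intro a ha
      obtain ⟨p, rfl⟩ := Ideal.Quotient.mk_surjective a
      have hp0 : aeval (0 : Fin N → ℝ) p = 0 := ha
      have := hmkK p
      rw [hp0, map_zero, sub_zero] at this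
      exact this
    have hKfg : K.FG := by
      have : IsNoetherianRing A := inferInstance
      exact IsNoetherian.noetherian K
    obtain ⟨r, hr, hrK⟩ :=
      Submodule.exists_sub_one_mem_and_smul_eq_zero_of_fg_of_le_smul K K hKfg hKK
    obtain ⟨p, rfl⟩ := Ideal.Quotient.mk_surjective r
    have hp1 : aeval (0 : Fin N → ℝ) p = 1 := by
      have : ε (mk p - 1) = 0 := hr
      rw [map_sub, map_one, sub_eq_zero] at this
      exact this
    have := hp p
    rw [hx, hp1, one_smul] at this
    exact hv0 (this.symm.trans (hrK v hvK))
  · have := hp (f i)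
    rw [hmkf, zero_mul, eq_comm, smul_eq_zero, or_iff_left hv0] at this
    simp only [hf, g, map_add, map_sub, map_mul, map_sum, map_pow, aeval_X, aeval_C,
      Algebra.algebraMap_self, RingHom.id_apply] at this
    linarith

/-- A quadratic map of a Euclidean space of positive dimension becomes, after arbitrarily small
perturbations by multiples of `x ↦ (x i ^ 2)`, a map with an eigenvector on the unit sphere. -/
theorem exists_unit_eigenvector_perturbed {N : ℕ} (hN : 0 < N)
    (B : EuclideanSpace ℝ (Fin N) →ₗ[ℝ] EuclideanSpace ℝ (Fin N) →ₗ[ℝ] EuclideanSpace ℝ (Fin N))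
    {δ : ℝ} (hδ : 0 < δ) :
    ∃ s : ℝ, 0 < s ∧ s < δ ∧ ∃ (u : EuclideanSpace ℝ (Fin N)) (c : ℝ), ‖u‖ = 1 ∧
      B u u + s • WithLp.toLp 2 (fun i => u i ^ 2) = c • u := by
  let e := EuclideanSpace.basisFun (Fin N) ℝ
  have hB (x : EuclideanSpace ℝ (Fin N)) (i : Fin N) :
      B x x i = ∑ j, ∑ k, B (e j) (e k) i * (x j * x k) := by
    have hx : x = ∑ j, x j • e j := by simpa [e] using (e.sum_repr x).symm
    have hl : B x x = ∑ j, ∑ k, (x j * x k) • B (e j) (e k) := by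
      conv_lhs => rw [hx]
      simp only [map_sum, map_smul, LinearMap.sum_apply, LinearMap.smul_apply, Finset.smul_sum,
        smul_smul]
      rw [Finset.sum_comm]
      simp only [mul_comm]
    rw [hl]
    simp [mul_comm]
  obtain ⟨s, hs, hs0, hsδ⟩ := ((countable_not_exists_quadratic_fixed_point hN
    fun i j k => B (e j) (e k) i).dense_compl ℝ).exists_between hδ
  simp only [Set.mem_compl_iff, Set.mem_ofPred_eq, not_not] at hs
  obtain ⟨x, hx0, hx⟩ := hs
  refine ⟨s, hs0, hsδ, ?_⟩
  set y : EuclideanSpace ℝ (Fin N) := WithLp.toLp 2 x with hy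
  have hy0 : y ≠ 0 := by simpa [hy] using hx0
  have hn : ‖y‖ ≠ 0 := norm_ne_zero_iff.mpr hy0
  refine ⟨‖y‖⁻¹ • y, ‖y‖⁻¹, ?_, ?_⟩
  · rw [norm_smul, norm_inv, norm_norm, inv_mul_cancel₀ hn]
  · ext i
    have := hx i
    rw [← hB y i] at this
    simp only [map_smul, LinearMap.smul_apply, PiLp.add_apply, PiLp.smul_apply, smul_eq_mul]
    have hyi : y i = x i := rfl
    rw [hyi]
    linear_combination ‖y‖⁻¹ ^ 2 * this

/-- If `Q x = B x x` is a homogeneous quadratic map on `ℝ^{n+1}` (with `B` symmetric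
bilinear) which vanishes only at the origin, then `Q` keeps a line invariant: there
are a unit vector `v` and `c > 0` with `Q v = c • v`. -/
theorem stmt12 (n : ℕ)
    (B : EuclideanSpace ℝ (Fin (n + 1)) →ₗ[ℝ] EuclideanSpace ℝ (Fin (n + 1)) →ₗ[ℝ]
      EuclideanSpace ℝ (Fin (n + 1)))
    (hsymm : ∀ x y, B x y = B y x)
    (Q : EuclideanSpace ℝ (Fin (n + 1)) → EuclideanSpace ℝ (Fin (n + 1)))
    (hQ : ∀ x, Q x = B x x)
    (hne : ∀ x : EuclideanSpace ℝ (Fin (n + 1)), x ≠ 0 → Q x ≠ 0) :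
    ∃ (v : EuclideanSpace ℝ (Fin (n + 1))) (c : ℝ), ‖v‖ = 1 ∧ 0 < c ∧ Q v = c • v := by
  let P (u w : EuclideanSpace ℝ (Fin (n + 1))) : EuclideanSpace ℝ (Fin (n + 1)) :=
    w - inner ℝ u w • u
  let S (u : EuclideanSpace ℝ (Fin (n + 1))) : EuclideanSpace ℝ (Fin (n + 1)) :=
    WithLp.toLp 2 fun i => u i ^ 2
  have hQc : Continuous Q := by
    have : Q = fun x => (LinearMap.toContinuousLinearMap
        ((LinearMap.toContinuousLinearMap :
          (EuclideanSpace ℝ (Fin (n + 1)) →ₗ[ℝ] EuclideanSpace ℝ (Fin (n + 1))) ≃ₗ[ℝ]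
            _).toLinearMap ∘ₗ B)) x x := by
      ext1 x
      simpa using hQ x
    rw [this]
    fun_prop
  have hSc : Continuous S := (PiLp.continuous_toLp 2 _).comp (by fun_prop)
  have hPQ : Continuous fun u => ‖P u (Q u)‖ := by fun_prop
  have hPS : Continuous fun u => ‖P u (S u)‖ := by fun_prop
  have hcpt : IsCompact (Metric.sphere (0 : EuclideanSpace ℝ (Fin (n + 1))) 1) :=
    isCompact_sphere 0 1
  have hne' : (Metric.sphere (0 : EuclideanSpace ℝ (Fin (n + 1))) 1).Nonempty :=
    NormedSpace.sphere_nonempty.mpr zero_le_one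
  obtain ⟨v, hv, hmin⟩ := hcpt.exists_isMinOn hne' hPQ.continuousOn
  obtain ⟨w, hw, hmax⟩ := hcpt.exists_isMaxOn hne' hPS.continuousOn
  have hzero : P v (Q v) = 0 := by
    by_contra hPv
    have hpos : 0 < ‖P v (Q v)‖ := norm_pos_iff.mpr hPv
    have hM : 0 < ‖P w (S w)‖ + 1 := by positivity
    obtain ⟨s, hs0, hs, u, c, hu, hc⟩ :=
      exists_unit_eigenvector_perturbed n.succ_pos B (div_pos hpos hM)
    have hus : u ∈ Metric.sphere (0 : EuclideanSpace ℝ (Fin (n + 1))) 1 := by simpa using hu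
    have hPu : P u (Q u) = -(s • P u (S u)) := by
      have hQu : Q u = c • u - s • S u := by rw [hQ, ← hc, add_sub_cancel_right]
      simp only [P, hQu, inner_sub_right, inner_smul_right, real_inner_self_eq_norm_sq, hu]
      module
    have h1 : ‖P v (Q v)‖ ≤ ‖P u (Q u)‖ := hmin hus
    have h2 : ‖P u (S u)‖ ≤ ‖P w (S w)‖ := hmax hus
    rw [hPu, norm_neg, norm_smul, Real.norm_of_nonneg hs0.le] at h1
    rw [lt_div_iff₀ hM] at hs
    nlinarith
  have hv1 : ‖v‖ = 1 := by simpa using hv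
  have hQv : Q v = inner ℝ v (Q v) • v := sub_eq_zero.mp hzero
  have hv0 : v ≠ 0 := norm_ne_zero_iff.mp (by rw [hv1]; exact one_ne_zero)
  have hc0 : inner ℝ v (Q v) ≠ 0 := fun h => hne v hv0 (by rw [hQv, h, zero_smul])
  rcases lt_or_gt_of_ne hc0 with hneg | hpos
  · refine ⟨-v, -inner ℝ v (Q v), by rwa [norm_neg], neg_pos.mpr hneg, ?_⟩
    rw [neg_smul_neg, ← hQv, hQ, hQ]
    simp
  · exact ⟨v, _, hv1, hpos, hQv⟩
end

section
/- Let n be a natural number, let E = ℝ^{n+1} be Euclidean space, let B : E → E → E be a symmetric bilinear map, and define the homogeneous quadratic map Q by Q(x) = B(x, x). Suppose Q(x) ≠ 0 for every nonzero x in E. Then the ODE dx/dt = Q(x) exhibits finite time blowup for some initial condition: there exist a vector A in E, a real number T > 0, and a function x : ℝ → E such that x(0) = A, x is differentiable at every t in [0, T) with derivative x'(t) = Q(x(t)), and ‖x(t)‖ tends to +∞ as t tends to T from the left. -/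
open Filter Set

/-- A real polynomial of odd degree has a real root. -/
theorem exists_isRoot_of_monic_of_odd {p : Polynomial ℝ} (hp : p.Monic) (ho : Odd p.natDegree) :
    ∃ x, p.IsRoot x := by
  have hpos : 0 < p.degree := Polynomial.natDegree_pos_iff_degree_pos.mp ho.pos
  have h1 : Tendsto (fun x => p.eval x) atTop atTop :=
    p.tendsto_atTop_of_leadingCoeff_nonneg hpos (by simp [hp.leadingCoeff])
  have h2 : Tendsto (fun x => (p.comp (-Polynomial.X)).eval x) atTop atBot := by
    refine Polynomial.tendsto_atBot_of_leadingCoeff_nonpos _ ?_ ?_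
    · rw [← Polynomial.natDegree_pos_iff_degree_pos, Polynomial.natDegree_comp]
      simpa using ho.pos
    · rw [Polynomial.leadingCoeff_comp (by simp)]
      simp [hp.leadingCoeff, ho.neg_one_pow]
  have hc : Continuous fun x => p.eval x := p.continuous
  obtain ⟨a, ha⟩ := (h1.eventually_ge_atTop 0).exists
  obtain ⟨b, hb⟩ := (h2.eventually_le_atBot 0).exists
  rw [Polynomial.eval_comp] at hb
  exact mem_range_of_exists_le_of_exists_ge hc ⟨_, hb⟩ ⟨a, ha⟩

/-- A family of endomorphisms which commute on an invariant subspace of odd dimension has a common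
eigenvector in that subspace. -/
theorem exists_common_eigenvector {ι V : Type*} [AddCommGroup V] [Module ℝ V]
    [FiniteDimensional ℝ V] (X : ι → Module.End ℝ V) (hX : ∀ i j, Commute (X i) (X j))
    (p : Submodule ℝ V) (hp : ∀ i, ∀ v ∈ p, X i v ∈ p) (ho : Odd (Module.finrank ℝ p)) :
    ∃ v ≠ 0, ∃ a : ι → ℝ, ∀ i, X i v = a i • v := by
  induction hd : Module.finrank ℝ p using Nat.strong_induction_on generalizing p with
  | _ d ih =>
  subst hd
  by_cases hs : ∀ i, ∃ a : ℝ, ∀ v ∈ p, X i v = a • v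
  · choose a ha using hs
    have : p ≠ ⊥ := by rintro rfl; simp at ho
    obtain ⟨v, hv, hv0⟩ := p.exists_mem_ne_zero_of_ne_bot this
    exact ⟨v, hv0, a, fun i => ha i v hv⟩
  push Not at hs
  obtain ⟨i, hi⟩ := hs
  let T : Module.End ℝ p := (X i).restrict (hp i)
  obtain ⟨c, hc⟩ := exists_isRoot_of_monic_of_odd T.charpoly_monic
    (by rwa [LinearMap.charpoly_natDegree])
  have hev : T.HasEigenvalue c := (Module.End.hasEigenvalue_iff_isRoot_charpoly T c).2 hc
  obtain ⟨w, hw⟩ := hev.exists_hasEigenvector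
  let S : Module.End ℝ p := T - c • 1
  have hSc : ∀ (j : ι) (v : p), ((S ⟨X j v, hp j v v.2⟩ : p) : V) = X j (S v : p) := by
    intro j v
    have := LinearMap.congr_fun (hX i j).eq (v : V)
    simp only [Module.End.mul_apply] at this
    simp [S, T, this]
  have hSw : S w = 0 := by
    have := hw.apply_eq_smul
    simp [S, this]
  have hrank := S.finrank_range_add_finrank_ker
  have hker : 0 < Module.finrank ℝ S.ker := by
    have : Nontrivial S.ker := ⟨⟨⟨w, hSw⟩, 0, fun h => hw.2 (by simpa using congrArg Subtype.val h)⟩⟩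
    exact Module.finrank_pos
  have hran : 0 < Module.finrank ℝ S.range := by
    obtain ⟨v, hv, hne⟩ := hi c
    have : Nontrivial S.range := ⟨⟨⟨S ⟨v, hv⟩, ⟨_, rfl⟩⟩, 0, fun h => hne (by
      have := congrArg (fun z : S.range => ((z : p) : V)) h
      simpa [S, T, sub_eq_zero] using this)⟩⟩
    exact Module.finrank_pos
  have key : ∀ r : Submodule ℝ p, (∀ j, ∀ v : p, v ∈ r → (⟨X j v, hp j v v.2⟩ : p) ∈ r) →
      Odd (Module.finrank ℝ r) → Module.finrank ℝ r < Module.finrank ℝ p →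
      ∃ v ≠ 0, ∃ a : ι → ℝ, ∀ i, X i v = a i • v := by
    intro r hr hodd hlt
    have hfr : Module.finrank ℝ (r.map p.subtype) = Module.finrank ℝ r :=
      Submodule.finrank_map_subtype_eq p r
    refine ih _ (hfr ▸ hlt) (r.map p.subtype) ?_ (hfr ▸ hodd) rfl
    rintro j _ ⟨v, hv, rfl⟩
    exact ⟨_, hr j v hv, rfl⟩
  rcases Nat.even_or_odd (Module.finrank ℝ S.ker) with he | he
  · refine key S.range ?_ ?_ (by omega)
    · rintro j _ ⟨v, rfl⟩
      exact ⟨_, Subtype.ext (hSc j v)⟩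
    · rw [← hrank] at ho
      exact (Nat.odd_add.1 ho).2 he
  · refine key S.ker ?_ he (by omega)
    intro j v hv
    rw [LinearMap.mem_ker] at hv ⊢
    ext
    rw [hSc, hv]
    simp

/-- Nondegenerate solutions of `x i = x i ^ 2` persist under a small perturbation. -/
theorem exists_root_near {ι : Type*} [Fintype ι] (q : (ι → ℝ) → ι → ℝ) (hq : ContDiff ℝ 1 q)
    (p : ι → ℝ) (hp : ∀ i, p i = p i ^ 2) :
    ∃ r : ℝ → ι → ℝ, Tendsto r (nhds 0) (nhds p) ∧
      ∀ᶠ t in nhds 0, ∀ i, r t i = r t i ^ 2 + t * q (r t) i := by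
  let F : ℝ × (ι → ℝ) → ι → ℝ := fun z i => z.2 i - z.2 i ^ 2 - z.1 * q z.2 i
  have hF : ContDiff ℝ 1 F := by
    rw [contDiff_pi] at hq ⊢
    intro i
    have h1 : ContDiff ℝ 1 fun z : ℝ × (ι → ℝ) => z.2 i := by fun_prop
    have h2 : ContDiff ℝ 1 fun z : ℝ × (ι → ℝ) => q z.2 i := (hq i).comp contDiff_snd
    exact (h1.sub (h1.pow 2)).sub (contDiff_fst.mul h2)
  have hs : HasStrictFDerivAt F (fderiv ℝ F (0, p)) (0, p) :=
    hF.contDiffAt.hasStrictFDerivAt one_ne_zero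
  let D : (ι → ℝ) →L[ℝ] (ι → ℝ) :=
    ContinuousLinearMap.pi fun i => (1 - 2 * p i) • ContinuousLinearMap.proj i
  have hD : (fderiv ℝ F (0, p)) ∘L .inr ℝ ℝ (ι → ℝ) = D := by
    have h1 : HasFDerivAt (fun x : ι → ℝ => F (0, x))
        ((fderiv ℝ F (0, p)) ∘L .inr ℝ ℝ (ι → ℝ)) p :=
      HasFDerivAt.comp p hs.hasFDerivAt (hasFDerivAt_prodMk_right (0 : ℝ) p)
    have h2 : HasFDerivAt (fun x : ι → ℝ => F (0, x)) D p := by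
      rw [hasFDerivAt_pi']
      intro i
      have h3 : HasFDerivAt (fun x : ι → ℝ => x i) (ContinuousLinearMap.proj (R := ℝ) i) p :=
        hasFDerivAt_apply i p
      have h4 := h3.sub (h3.pow 2)
      refine (h4.congr_fderiv ?_).congr_of_eventuallyEq (Eventually.of_forall fun x => ?_)
      · ext v
        simp [D]
        ring
      · simp [F]
    exact h1.unique h2
  have hDD : D.comp D = .id ℝ (ι → ℝ) := by
    ext v i
    simp only [D, ContinuousLinearMap.comp_apply, ContinuousLinearMap.coe_pi',
      _root_.smul_apply, ContinuousLinearMap.proj_apply, smul_eq_mul,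
      ContinuousLinearMap.id_apply]
    linear_combination -4 * v i * hp i
  have hinv : ((fderiv ℝ F (0, p)) ∘L .inr ℝ ℝ (ι → ℝ)).IsInvertible := by
    rw [hD]
    exact .of_inverse hDD hDD
  refine ⟨_, hs.tendsto_implicitFunctionOfProdDomain hinv, ?_⟩
  filter_upwards [hs.eventually_apply_implicitFunctionOfProdDomain hinv] with t ht i
  have h := congrFun ht i
  simp only [F] at h
  linear_combination h + hp i

section QuadraticSystem

open Polynomial Matrix

variable {ι : Type*} [Fintype ι] [DecidableEq ι]

/-- Nonconstant monomials of degree at most `card ι + 1` in variables indexed by `ι`, as multisets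
of variables. -/
abbrev BoundedMonomial (ι : Type*) [Fintype ι] : Type _ :=
  {m : Multiset ι // m ≠ 0 ∧ m.card ≤ Fintype.card ι + 1}

/-- Nonconstant squarefree monomials in variables indexed by `ι`, as sets of variables. -/
abbrev SquarefreeMonomial (ι : Type*) : Type _ := {S : Finset ι // S.Nonempty}

noncomputable instance : Fintype (BoundedMonomial ι) :=
  Fintype.ofInjective
    (fun m => (⟨⟨m.1.card, by have := m.2.2; omega⟩, ⟨m.1, rfl⟩⟩ :
      Σ k : Fin (Fintype.card ι + 2), Sym ι k))
    fun m m' h => by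
      have h' := congrArg (fun z : Σ k : Fin (Fintype.card ι + 2), Sym ι k => (z.2 : Multiset ι)) h
      exact Subtype.ext h'

/-- The coefficient vector of a monomial. -/
noncomputable def monomialVec (s t : Multiset ι) : ℝ[X] := if t = s then 1 else 0

open Classical in
/-- The coefficient vector of `m`, if `m` is squarefree, and otherwise of `m' * f i`, where
`m = x i ^ 2 * m'` and `f i = x i ^ 2 - x i + X * ∑ j, ∑ k, b i j k * x j * x k`. -/
noncomputable def relationVec (b : ι → ι → ι → ℝ) (m t : Multiset ι) : ℝ[X] :=
  if h : ∃ i m', m = i ::ₘ i ::ₘ m' then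
    monomialVec m t - monomialVec (h.choose ::ₘ h.choose_spec.choose) t +
      X * ∑ j, ∑ k, C (b h.choose j k) * monomialVec (j ::ₘ k ::ₘ h.choose_spec.choose) t
  else monomialVec m t

/-- The square matrix with columns `relationVec`. -/
noncomputable def relationMatrix (b : ι → ι → ι → ℝ) :
    Matrix (BoundedMonomial ι) (BoundedMonomial ι) ℝ[X] :=
  of fun t m => relationVec b m t

/-- The projection onto squarefree monomials. -/
noncomputable def squarefreeProj (ι : Type*) [DecidableEq ι] [Fintype ι] :
    Matrix (SquarefreeMonomial ι) (BoundedMonomial ι) ℝ[X] :=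
  of fun S m => if m.1 = S.1.val then 1 else 0

/-- Multiplication of a squarefree monomial by a variable. -/
noncomputable def variableMul (i : ι) : Matrix (BoundedMonomial ι) (SquarefreeMonomial ι) ℝ[X] :=
  of fun t S => monomialVec (i ::ₘ S.1.val) t

/-- The determinant of the relation matrix, times multiplication by the variable `i` modulo the
relations, in the basis of squarefree monomials. -/
noncomputable def scaledMul (b : ι → ι → ι → ℝ) (i : ι) :
    Matrix (SquarefreeMonomial ι) (SquarefreeMonomial ι) ℝ[X] :=
  squarefreeProj ι * (relationMatrix b).adjugate * variableMul i

theorem sum_mul_monomialVec (e : Multiset ι → ℝ) (τ : ℝ) {s : Multiset ι} (h0 : s ≠ 0)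
    (hs : s.card ≤ Fintype.card ι + 1) :
    ∑ t : BoundedMonomial ι, e t * (monomialVec s t).eval τ = e s := by
  rw [Finset.sum_eq_single ⟨s, h0, hs⟩]
  · simp [monomialVec]
  · intro t _ ht
    have : t.1 ≠ s := fun h => ht (Subtype.ext h)
    simp [monomialVec, this]
  · simp

theorem sum_mul_relationMatrix_of_nodup (b : ι → ι → ι → ℝ) (e : Multiset ι → ℝ) (τ : ℝ)
    (m : BoundedMonomial ι) (hm : m.1.Nodup) :
    ∑ t : BoundedMonomial ι, e t * (relationMatrix b t m).eval τ = e m := by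
  rw [← sum_mul_monomialVec e τ m.2.1 m.2.2]
  refine Finset.sum_congr rfl fun t _ => ?_
  rw [relationMatrix, of_apply, relationVec, dif_neg]
  rintro ⟨i, m', h⟩
  exact Multiset.nodup_iff_ne_cons_cons.1 hm i m' h

theorem exists_sum_mul_relationMatrix (b : ι → ι → ι → ℝ) (m : BoundedMonomial ι)
    (hm : ¬ m.1.Nodup) : ∃ i m', m.1 = i ::ₘ i ::ₘ m' ∧ ∀ (e : Multiset ι → ℝ) (τ : ℝ),
      ∑ t : BoundedMonomial ι, e t * (relationMatrix b t m).eval τ =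
        e m - e (i ::ₘ m') + τ * ∑ j, ∑ k, b i j k * e (j ::ₘ k ::ₘ m') := by
  have h : ∃ i m', m.1 = i ::ₘ i ::ₘ m' := by
    simpa [Multiset.nodup_iff_ne_cons_cons] using hm
  refine ⟨h.choose, h.choose_spec.choose, h.choose_spec.choose_spec, fun e τ => ?_⟩
  have heq := h.choose_spec.choose_spec
  have hcard := m.2.2
  rw [heq] at hcard
  simp only [Multiset.card_cons] at hcard
  simp only [relationMatrix, of_apply, relationVec, dif_pos h]
  generalize h.choose_spec.choose = m' at *
  generalize h.choose = i at *
  simp only [eval_add, eval_sub, eval_mul, eval_X, eval_finsetSum, eval_C, mul_add, mul_sub,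
    Finset.sum_add_distrib, Finset.sum_sub_distrib]
  rw [sum_mul_monomialVec e τ m.2.1 m.2.2,
    sum_mul_monomialVec e τ (Multiset.cons_ne_zero) (by simp; omega)]
  congr 1
  have (j k : ι) : e (j ::ₘ k ::ₘ m') =
      ∑ t : BoundedMonomial ι, e t * (monomialVec (j ::ₘ k ::ₘ m') t).eval τ :=
    (sum_mul_monomialVec e τ Multiset.cons_ne_zero (by simp; omega)).symm
  simp only [this, Finset.mul_sum]
  rw [Finset.sum_comm]
  refine Finset.sum_congr rfl fun j _ => ?_
  rw [Finset.sum_comm]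
  refine Finset.sum_congr rfl fun k _ => Finset.sum_congr rfl fun t _ => ?_
  ring

theorem relationMatrix_det_ne_zero (b : ι → ι → ι → ℝ) : (relationMatrix b).det ≠ 0 := by
  intro h
  have h0 : ((evalRingHom (0 : ℝ)).mapMatrix (relationMatrix b)).det = 0 := by
    rw [← RingHom.map_det, h, map_zero]
  obtain ⟨w, hw, hw0⟩ := exists_vecMul_eq_zero_iff.2 h0
  refine hw (funext fun m => ?_)
  let e : Multiset ι → ℝ := fun s =>
    if hs : s ≠ 0 ∧ s.card ≤ Fintype.card ι + 1 then w ⟨s, hs⟩ else 0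
  have he (t : BoundedMonomial ι) : e t = w t := dif_pos t.2
  have hsum (m : BoundedMonomial ι) : ∑ t : BoundedMonomial ι, e t * (relationMatrix b t m).eval 0 = 0 := by
    have := congrFun hw0 m
    simpa [vecMul, dotProduct, he] using this
  induction hd : m.1.card using Nat.strong_induction_on generalizing m with
  | _ d ih =>
  by_cases hm : m.1.Nodup
  · rw [← he, ← sum_mul_relationMatrix_of_nodup b e 0 m hm, hsum]
    rfl
  · obtain ⟨i, m', hmi, hs⟩ := exists_sum_mul_relationMatrix b m hm
    have hcard := m.2.2
    rw [hmi] at hcard hd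
    simp only [Multiset.card_cons] at hcard hd
    have h1 : e (i ::ₘ m') = 0 := by
      have := ih (i ::ₘ m').card (by simp; omega)
        ⟨i ::ₘ m', Multiset.cons_ne_zero, by simp; omega⟩ rfl
      rw [← he] at this
      exact this
    have h2 := hs e 0
    rw [hsum, h1] at h2
    rw [← he]
    simpa using h2.symm

/-- The values of the squarefree monomials at the points `r`. -/
noncomputable def squarefreeEval (r : SquarefreeMonomial ι → ι → ℝ) :
    Matrix (SquarefreeMonomial ι) (SquarefreeMonomial ι) ℝ :=
  of fun σ S => ∏ i ∈ S.1, r σ i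

theorem squarefreeEval_mul_scaledMul (b : ι → ι → ι → ℝ) (τ : ℝ)
    (r : SquarefreeMonomial ι → ι → ℝ)
    (hr : ∀ σ i, r σ i = r σ i ^ 2 + τ * ∑ j, ∑ k, b i j k * (r σ j * r σ k)) (i : ι) :
    squarefreeEval r * (evalRingHom τ).mapMatrix (scaledMul b i) =
      (relationMatrix b).det.eval τ • (diagonal (fun σ => r σ i) * squarefreeEval r) := by
  let W : Matrix (SquarefreeMonomial ι) (BoundedMonomial ι) ℝ :=
    of fun σ m => (m.1.map (r σ)).prod
  have h1 : squarefreeEval r * (squarefreeProj ι).map (evalRingHom τ) =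
      W * (relationMatrix b).map (evalRingHom τ) := by
    ext σ m
    simp only [mul_apply, map_apply, coe_evalRingHom, W, of_apply]
    by_cases hm : m.1.Nodup
    · rw [sum_mul_relationMatrix_of_nodup b (fun s => (s.map (r σ)).prod) τ m hm,
        Finset.sum_eq_single ⟨⟨m.1, hm⟩, by
          rw [Finset.nonempty_iff_ne_empty]
          exact fun h => m.2.1 (congrArg Finset.val h)⟩]
      · simp [squarefreeProj, squarefreeEval]
      · intro S _ hS
        have : m.1 ≠ S.1.val := fun h => hS (Subtype.ext (Finset.val_injective h.symm))
        simp [squarefreeProj, this]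
      · simp
    · obtain ⟨i, m', hmi, hs⟩ := exists_sum_mul_relationMatrix b m hm
      rw [hs (fun s => (s.map (r σ)).prod), Finset.sum_eq_zero]
      · rw [hmi]
        simp only [Multiset.map_cons, Multiset.prod_cons]
        have : ∑ j, ∑ k, b i j k * (r σ j * (r σ k * (m'.map (r σ)).prod)) =
            (∑ j, ∑ k, b i j k * (r σ j * r σ k)) * (m'.map (r σ)).prod := by
          simp only [Finset.sum_mul, mul_assoc]
        rw [this]
        linear_combination (m'.map (r σ)).prod * hr σ i
      · intro S _
        have : m.1 ≠ S.1.val := fun h => hm (h ▸ S.1.nodup)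
        simp [squarefreeProj, this]
  have h2 : W * (variableMul i).map (evalRingHom τ) =
      diagonal (fun σ => r σ i) * squarefreeEval r := by
    ext σ S
    rw [diagonal_mul, mul_apply]
    simp only [map_apply, coe_evalRingHom, W, of_apply, variableMul]
    rw [sum_mul_monomialVec (fun s => (s.map (r σ)).prod) τ Multiset.cons_ne_zero]
    · simp [squarefreeEval]
    · simpa using Finset.card_le_univ S.1
  have h3 : (relationMatrix b).map (evalRingHom τ) *
      (relationMatrix b).adjugate.map (evalRingHom τ) = (relationMatrix b).det.eval τ • 1 := by
    rw [← Matrix.map_mul, mul_adjugate]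
    ext t m
    simp [Matrix.one_apply, apply_ite (eval τ)]
  rw [RingHom.mapMatrix_apply, scaledMul, Matrix.map_mul, Matrix.map_mul, ← Matrix.mul_assoc,
    ← Matrix.mul_assoc, h1, Matrix.mul_assoc W, h3, Matrix.mul_smul, Matrix.mul_one,
    Matrix.smul_mul, h2]

theorem eventually_exists_roots (b : ι → ι → ι → ℝ) : ∀ᶠ τ in nhds (0 : ℝ),
    ∃ r : SquarefreeMonomial ι → ι → ℝ,
      (∀ σ i, r σ i = r σ i ^ 2 + τ * ∑ j, ∑ k, b i j k * (r σ j * r σ k)) ∧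
      (squarefreeEval r).det ≠ 0 := by
  let p : SquarefreeMonomial ι → ι → ℝ := fun σ i => if i ∈ σ.1 then 1 else 0
  have hq : ContDiff ℝ 1 fun (x : ι → ℝ) i => ∑ j, ∑ k, b i j k * (x j * x k) := by fun_prop
  choose r hrt hr using fun σ => exists_root_near _ hq (p σ) (by intro i; simp [p])
  have hdet : (squarefreeEval p).det ≠ 0 := by
    intro h
    obtain ⟨w, hw, hw0⟩ := exists_mulVec_eq_zero_iff.2 h
    refine hw (funext fun σ => ?_)
    induction hd : σ.1.card using Nat.strong_induction_on generalizing σ with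
    | _ d ih =>
    have := congrFun hw0 σ
    simp only [mulVec, dotProduct, squarefreeEval, of_apply, p, Pi.zero_apply] at this
    rw [Finset.sum_eq_single σ] at this
    · simpa +contextual [Finset.prod_ite_mem] using this
    · intro S _ hS
      by_cases hsub : S.1 ⊆ σ.1
      · have hlt : S.1.card < σ.1.card := Finset.card_lt_card
          (hsub.ssubset_of_ne fun h => hS (Subtype.ext h))
        rw [ih _ (hd ▸ hlt) S rfl]
        simp
      · obtain ⟨i, hi, hn⟩ := Finset.not_subset.1 hsub
        rw [Finset.prod_eq_zero hi (by simp [hn]), zero_mul]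
    · simp
  have hcont : Continuous fun r : SquarefreeMonomial ι → ι → ℝ => (squarefreeEval r).det := by
    refine Continuous.matrix_det (continuous_matrix fun σ S => ?_)
    simp only [squarefreeEval, of_apply]
    fun_prop
  have ht : Tendsto (fun τ => (squarefreeEval fun σ => r σ τ).det) (nhds 0)
      (nhds (squarefreeEval p).det) :=
    (hcont.tendsto p).comp (tendsto_pi_nhds.2 hrt)
  filter_upwards [ht.eventually_ne hdet, eventually_all.2 hr] with τ h1 h2
  exact ⟨fun σ => r σ τ, h2, h1⟩

theorem eq_of_eventually_eval_eq {p q : ℝ[X]} (h : ∀ᶠ τ in nhds 0, p.eval τ = q.eval τ) :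
    p = q :=
  eq_of_infinite_eval_eq p q (infinite_of_mem_nhds 0 h)

theorem matrix_eq_of_eventually_map_eq {m n : Type*} [Finite m] [Finite n] {P R : Matrix m n ℝ[X]}
    (h : ∀ᶠ τ in nhds 0, P.map (evalRingHom τ) = R.map (evalRingHom τ)) : P = R := by
  ext1 i j
  refine eq_of_eventually_eval_eq (h.mono fun τ hτ => ?_)
  simpa using congrFun (congrFun hτ i) j

theorem mul_left_cancel_of_det_ne_zero {n : Type*} [Fintype n] [DecidableEq n] {m : Type*}
    {V : Matrix n n ℝ} (hV : V.det ≠ 0) {P R : Matrix n m ℝ} (h : V * P = V * R) : P = R := by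
  have := congrArg (V⁻¹ * ·) h
  simpa [← Matrix.mul_assoc, nonsing_inv_mul V (isUnit_iff_ne_zero.2 hV)] using this

theorem scaledMul_mul_scaledMul_comm (b : ι → ι → ι → ℝ) (i j : ι) :
    scaledMul b i * scaledMul b j = scaledMul b j * scaledMul b i := by
  refine matrix_eq_of_eventually_map_eq ((eventually_exists_roots b).mono fun τ ⟨r, hr, hdet⟩ => ?_)
  have h := squarefreeEval_mul_scaledMul b τ r hr
  simp only [RingHom.mapMatrix_apply] at h
  refine mul_left_cancel_of_det_ne_zero hdet ?_
  simp only [Matrix.map_mul, ← Matrix.mul_assoc, h, Matrix.smul_mul]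
  simp only [Matrix.mul_assoc, h, Matrix.mul_smul]
  simp only [← Matrix.mul_assoc, diagonal_mul_diagonal, mul_comm]

theorem det_smul_scaledMul (b : ι → ι → ι → ℝ) (i : ι) :
    (relationMatrix b).det • scaledMul b i = scaledMul b i * scaledMul b i +
      (X : ℝ[X]) • ∑ j, ∑ k, C (b i j k) • (scaledMul b j * scaledMul b k) := by
  refine matrix_eq_of_eventually_map_eq ((eventually_exists_roots b).mono fun τ ⟨r, hr, hdet⟩ => ?_)
  have h := squarefreeEval_mul_scaledMul b τ r hr
  simp only [RingHom.mapMatrix_apply] at h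
  have h2 (j k : ι) : squarefreeEval r * ((scaledMul b j).map (evalRingHom τ) *
      (scaledMul b k).map (evalRingHom τ)) = (relationMatrix b).det.eval τ ^ 2 •
        (diagonal (fun σ => r σ j * r σ k) * squarefreeEval r) := by
    rw [← Matrix.mul_assoc, h, Matrix.smul_mul, Matrix.mul_assoc, h, Matrix.mul_smul,
      ← Matrix.mul_assoc, diagonal_mul_diagonal, smul_smul, sq]
  refine mul_left_cancel_of_det_ne_zero hdet ?_
  have h3 : ((relationMatrix b).det • scaledMul b i).map (evalRingHom τ) =
      (relationMatrix b).det.eval τ • (scaledMul b i).map (evalRingHom τ) := by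
    ext S T
    simp
  have h4 : (scaledMul b i * scaledMul b i +
      (X : ℝ[X]) • ∑ j, ∑ k, C (b i j k) • (scaledMul b j * scaledMul b k)).map (evalRingHom τ) =
      (scaledMul b i).map (evalRingHom τ) * (scaledMul b i).map (evalRingHom τ) +
      τ • ∑ j, ∑ k, b i j k •
        ((scaledMul b j).map (evalRingHom τ) * (scaledMul b k).map (evalRingHom τ)) := by
    simp only [← Matrix.map_mul]
    ext S T
    simp [Matrix.sum_apply, eval_finsetSum]
  rw [h3, h4, Matrix.mul_smul, h, Matrix.mul_add, h2, Matrix.mul_smul]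
  simp only [Matrix.mul_sum, Matrix.mul_smul, h2]
  ext σ S
  simp only [Matrix.smul_apply, Matrix.add_apply, Matrix.sum_apply, diagonal_mul, smul_eq_mul]
  have h5 : ∑ j, ∑ k, b i j k * ((relationMatrix b).det.eval τ ^ 2 *
      (r σ j * r σ k * squarefreeEval r σ S)) = (relationMatrix b).det.eval τ ^ 2 *
        squarefreeEval r σ S * ∑ j, ∑ k, b i j k * (r σ j * r σ k) := by
    simp only [Finset.mul_sum]
    refine Finset.sum_congr rfl fun j _ => Finset.sum_congr rfl fun k _ => ?_
    ring
  rw [h5]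
  linear_combination (relationMatrix b).det.eval τ ^ 2 * squarefreeEval r σ S * hr σ i

theorem scaledMul_apply_of_notMem (b : ι → ι → ι → ℝ) {i : ι} {S : SquarefreeMonomial ι}
    (hi : i ∉ S.1) (T : SquarefreeMonomial ι) :
    scaledMul b i T S = if T.1 = insert i S.1 then (relationMatrix b).det else 0 := by
  let R : Matrix (SquarefreeMonomial ι) Unit ℝ[X] :=
    of fun T _ => if T.1 = insert i S.1 then (relationMatrix b).det else 0
  suffices h : (of fun T _ => scaledMul b i T S) = R from congrFun (congrFun h T) ()
  refine matrix_eq_of_eventually_map_eq ((eventually_exists_roots b).mono fun τ ⟨r, hr, hdet⟩ => ?_)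
  have h := squarefreeEval_mul_scaledMul b τ r hr i
  refine mul_left_cancel_of_det_ne_zero hdet ?_
  ext σ u
  have h1 := congrFun (congrFun h σ) S
  rw [mul_apply] at h1
  simp only [RingHom.mapMatrix_apply, Matrix.map_apply, coe_evalRingHom, Matrix.smul_apply,
    diagonal_mul, smul_eq_mul] at h1
  simp only [mul_apply, Matrix.map_apply, of_apply, coe_evalRingHom, h1, R]
  rw [Finset.sum_eq_single ⟨insert i S.1, Finset.insert_nonempty _ _⟩]
  · simp [squarefreeEval, Finset.prod_insert hi]
    ring
  · intro T _ hT
    rw [if_neg fun h => hT (Subtype.ext h)]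
    simp
  · simp

theorem scaledMul_sum_singleton (b : ι → ι → ι → ℝ) (i : ι) (T : SquarefreeMonomial ι) :
    (if T.1 = {i} then (relationMatrix b).det else 0) =
      scaledMul b i T ⟨{i}, Finset.singleton_nonempty i⟩ +
        X * ∑ j, ∑ k, C (b i j k) * scaledMul b j T ⟨{k}, Finset.singleton_nonempty k⟩ := by
  let P : Matrix (SquarefreeMonomial ι) Unit ℝ[X] :=
    of fun T _ => if T.1 = {i} then (relationMatrix b).det else 0
  let R : Matrix (SquarefreeMonomial ι) Unit ℝ[X] := of fun T _ =>
    scaledMul b i T ⟨{i}, Finset.singleton_nonempty i⟩ +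
        X * ∑ j, ∑ k, C (b i j k) * scaledMul b j T ⟨{k}, Finset.singleton_nonempty k⟩
  suffices h : P = R from congrFun (congrFun h T) ()
  refine matrix_eq_of_eventually_map_eq ((eventually_exists_roots b).mono fun τ ⟨r, hr, hdet⟩ => ?_)
  refine mul_left_cancel_of_det_ne_zero hdet ?_
  ext σ u
  have h1 (j k : ι) : ∑ T, squarefreeEval r σ T *
      (scaledMul b j T ⟨{k}, Finset.singleton_nonempty k⟩).eval τ =
        (relationMatrix b).det.eval τ * (r σ j * r σ k) := by
    have h := congrFun (congrFun (squarefreeEval_mul_scaledMul b τ r hr j) σ)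
      ⟨{k}, Finset.singleton_nonempty k⟩
    rw [mul_apply] at h
    simpa [diagonal_mul, squarefreeEval] using h
  simp only [mul_apply, Matrix.map_apply, of_apply, coe_evalRingHom, P, R, eval_add, eval_mul,
    eval_X, eval_finsetSum, eval_C, mul_add, Finset.sum_add_distrib, h1]
  have h2 : ∑ T, squarefreeEval r σ T * (τ * ∑ j, ∑ k, b i j k *
      (scaledMul b j T ⟨{k}, Finset.singleton_nonempty k⟩).eval τ) =
        τ * ∑ j, ∑ k, b i j k * ((relationMatrix b).det.eval τ * (r σ j * r σ k)) := by
    simp only [← h1, Finset.mul_sum]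
    rw [Finset.sum_comm]
    refine Finset.sum_congr rfl fun j _ => ?_
    rw [Finset.sum_comm]
    refine Finset.sum_congr rfl fun k _ => Finset.sum_congr rfl fun T _ => ?_
    ring
  have h3 : ∑ j, ∑ k, b i j k * ((relationMatrix b).det.eval τ * (r σ j * r σ k)) =
      (relationMatrix b).det.eval τ * ∑ j, ∑ k, b i j k * (r σ j * r σ k) := by
    simp only [Finset.mul_sum]
    refine Finset.sum_congr rfl fun j _ => Finset.sum_congr rfl fun k _ => ?_
    ring
  rw [h2, h3, Finset.sum_eq_single ⟨{i}, Finset.singleton_nonempty i⟩]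
  · simp only [if_true, squarefreeEval, of_apply, Finset.prod_singleton]
    linear_combination (relationMatrix b).det.eval τ * hr σ i
  · intro T _ hT
    rw [if_neg fun h => hT (Subtype.ext h)]
    simp
  · simp

theorem odd_card_squarefreeMonomial [Nonempty ι] : Odd (Fintype.card (SquarefreeMonomial ι)) := by
  have h : Fintype.card (SquarefreeMonomial ι) = 2 ^ Fintype.card ι - 1 := by
    simp only [SquarefreeMonomial, Finset.nonempty_iff_ne_empty]
    rw [Fintype.card_subtype_compl]
    simp
  rw [h]
  exact Nat.Even.sub_odd Nat.one_le_two_pow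
    (Nat.even_pow.2 ⟨even_two, Fintype.card_ne_zero⟩) odd_one

/-- For all but finitely many `τ`, the system `x i = x i ^ 2 + τ * ∑ j, ∑ k, b i j k * x j * x k`
has a nonzero real solution. -/
theorem exists_ne_zero_solution [Nonempty ι] (b : ι → ι → ι → ℝ) {τ : ℝ}
    (hτ : (relationMatrix b).det.eval τ ≠ 0) :
    ∃ x : ι → ℝ, x ≠ 0 ∧ ∀ i, x i = x i ^ 2 + τ * ∑ j, ∑ k, b i j k * (x j * x k) := by
  set c := (relationMatrix b).det.eval τ with hc
  let A (i : ι) := (scaledMul b i).map (evalRingHom τ)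
  have hcomm (i j : ι) : A i * A j = A j * A i := by
    simp only [A, ← Matrix.map_mul, scaledMul_mul_scaledMul_comm]
  obtain ⟨φ, hφ, a, ha⟩ := exists_common_eigenvector (fun i => (A i).vecMulLinear)
    (fun i j => LinearMap.ext fun v => by simp [vecMul_vecMul, hcomm]) ⊤ (fun _ _ _ => trivial)
    (by simpa using odd_card_squarefreeMonomial (ι := ι))
  simp only [vecMulLinear_apply] at ha
  refine ⟨fun i => a i / c, fun h0 => hφ ?_, fun i => ?_⟩
  · have ha0 (i : ι) (S : SquarefreeMonomial ι) :
        ∑ T, φ T * (scaledMul b i T S).eval τ = 0 := by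
      have h1 : a i = 0 := by simpa [hτ] using congrFun h0 i
      have h2 := congrFun (ha i) S
      simpa [h1, A, vecMul, dotProduct] using h2
    have hsingle (U : SquarefreeMonomial ι)
        (hU : ∑ T : SquarefreeMonomial ι,
          φ T * (if T.1 = U.1 then (relationMatrix b).det else 0).eval τ = 0) : φ U = 0 := by
      rw [Finset.sum_eq_single U] at hU
      · simpa [← hc, hτ] using hU
      · intro T _ hT
        rw [if_neg fun h => hT (Subtype.ext h)]
        simp
      · simp
    funext U
    refine hsingle U ?_
    obtain ⟨i, hi⟩ := U.2
    rcases (U.1.erase i).eq_empty_or_nonempty with he | he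
    · have hU : U.1 = {i} := by rw [← Finset.insert_erase hi, he, insert_empty_eq]
      simp only [hU, scaledMul_sum_singleton, eval_add, eval_mul, eval_X, eval_finsetSum, eval_C,
        mul_add, Finset.sum_add_distrib, ha0, zero_add]
      have : ∑ T, φ T * (τ * ∑ j, ∑ k, b i j k *
          (scaledMul b j T ⟨{k}, Finset.singleton_nonempty k⟩).eval τ) =
          τ * ∑ j, ∑ k, b i j k * ∑ T, φ T *
            (scaledMul b j T ⟨{k}, Finset.singleton_nonempty k⟩).eval τ := by
        simp only [Finset.mul_sum]
        rw [Finset.sum_comm]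
        refine Finset.sum_congr rfl fun j _ => ?_
        rw [Finset.sum_comm]
        refine Finset.sum_congr rfl fun k _ => Finset.sum_congr rfl fun T _ => ?_
        ring
      rw [this]
      simp [ha0]
    · rw [← ha0 i ⟨U.1.erase i, he⟩]
      refine Finset.sum_congr rfl fun T _ => ?_
      rw [scaledMul_apply_of_notMem b (Finset.notMem_erase i U.1), Finset.insert_erase hi]
  · have hmul (j k : ι) : φ ᵥ* (A j * A k) = (a j * a k) • φ := by
      rw [← vecMul_vecMul, ha, smul_vecMul, ha, smul_smul]
    have h1 : c • A i = A i * A i + τ • ∑ j, ∑ k, b i j k • (A j * A k) := by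
      have := congrArg (fun M => M.map (evalRingHom τ)) (det_smul_scaledMul b i)
      simp only [A, ← Matrix.map_mul]
      ext S T
      have := congrFun (congrFun this S) T
      simpa [Matrix.sum_apply, eval_finsetSum, hc] using this
    obtain ⟨S, hS⟩ := Function.ne_iff.1 hφ
    have h2 := congrFun (congrArg (φ ᵥ* ·) h1) S
    simp only [vecMul_smul, vecMul_add, ha, hmul, vecMul_sum, Pi.add_apply, Pi.smul_apply,
      Finset.sum_apply, smul_eq_mul] at h2
    simp only [← mul_assoc, ← Finset.sum_mul] at h2
    simp only [mul_assoc] at h2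
    have h3 : ∑ j, ∑ k, b i j k * (a j / c * (a k / c)) =
        (∑ j, ∑ k, b i j k * (a j * a k)) / c ^ 2 := by
      simp only [Finset.sum_div]
      refine Finset.sum_congr rfl fun j _ => Finset.sum_congr rfl fun k _ => ?_
      field_simp
    rw [h3]
    generalize ∑ j, ∑ k, b i j k * (a j * a k) = s at h2
    field_simp
    have h4 : φ S ≠ 0 := hS
    refine mul_right_cancel₀ h4 ?_
    linear_combination h2

end QuadraticSystem

theorem bilin_apply_self_eq_sum {ι : Type*} [Fintype ι] [DecidableEq ι]
    (B : EuclideanSpace ℝ ι →ₗ[ℝ] EuclideanSpace ℝ ι →ₗ[ℝ] EuclideanSpace ℝ ι)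
    (x : EuclideanSpace ℝ ι) (i : ι) :
    B x x i = ∑ j, ∑ k, B (EuclideanSpace.single j 1) (EuclideanSpace.single k 1) i *
      (x j * x k) := by
  have hx : x = ∑ j, x j • EuclideanSpace.single j (1 : ℝ) := by
    simpa using ((EuclideanSpace.basisFun ι ℝ).sum_repr x).symm
  conv_lhs => rw [hx]
  simp only [map_sum, map_smul, LinearMap.sum_apply, LinearMap.smul_apply, WithLp.ofLp_sum,
    Finset.sum_apply, PiLp.smul_apply, smul_eq_mul]
  rw [Finset.sum_comm]
  simp only [Finset.mul_sum]
  refine Finset.sum_congr rfl fun j _ => Finset.sum_congr rfl fun k _ => ?_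
  ring

/-- A quadratic map without nonzero zeros maps some nonzero vector to a positive multiple of
itself. -/
theorem exists_pos_quadratic_eigenvector {ι : Type*} [Fintype ι] [DecidableEq ι] [Nonempty ι]
    (B : EuclideanSpace ℝ ι →ₗ[ℝ] EuclideanSpace ℝ ι →ₗ[ℝ] EuclideanSpace ℝ ι)
    (hne : ∀ x, x ≠ 0 → B x x ≠ 0) : ∃ y ≠ 0, ∃ c : ℝ, 0 < c ∧ B y y = c • y := by
  let b (i j k : ι) : ℝ := B (EuclideanSpace.single j 1) (EuclideanSpace.single k 1) i
  have hB (x : EuclideanSpace ℝ ι) (i : ι) : B x x i = ∑ j, ∑ k, b i j k * (x j * x k) :=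
    bilin_apply_self_eq_sum B x i
  have hcont (i : ι) : Continuous fun x : EuclideanSpace ℝ ι => B x x i := by
    simp only [hB]
    fun_prop
  have hunit : ∀ᶠ τ : ℝ in atTop, ∃ y ∈ Metric.sphere (0 : EuclideanSpace ℝ ι) 1,
      ∃ c ≥ 0, ∀ i, B y y i = c * y i - τ⁻¹ * y i ^ 2 := by
    filter_upwards [(relationMatrix b).det.eventually_atTop_not_isRoot (relationMatrix_det_ne_zero b),
      eventually_gt_atTop 0] with τ hτ hpos
    obtain ⟨x, hx0, hx⟩ := exists_ne_zero_solution b hτ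
    let z : EuclideanSpace ℝ ι := WithLp.toLp 2 x
    have hz : z ≠ 0 := fun h => hx0 (by simpa [z] using congrArg WithLp.ofLp h)
    have hn : 0 < ‖z‖ := norm_pos_iff.2 hz
    refine ⟨‖z‖⁻¹ • z, by simp [norm_smul, hn.ne'], (τ * ‖z‖)⁻¹, by positivity, fun i => ?_⟩
    have h1 := hx i
    have h2 : B z z i = ∑ j, ∑ k, b i j k * (x j * x k) := hB z i
    rw [← h2] at h1
    have h3 : z i = x i := rfl
    simp only [map_smul, LinearMap.smul_apply, PiLp.smul_apply, smul_eq_mul, h3]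
    field_simp
    linear_combination -h1
  obtain ⟨N, hN⟩ := eventually_atTop.1 (tendsto_natCast_atTop_atTop.eventually hunit)
  choose y hy c hc hyc using fun m : ℕ => hN (m + N) (by omega)
  obtain ⟨v, hv, s, hs, hlim⟩ := (isCompact_sphere (0 : EuclideanSpace ℝ ι) 1).tendsto_subseq hy
  have hinv : Tendsto (fun m => ((s m + N : ℕ) : ℝ)⁻¹) atTop (nhds 0) :=
    tendsto_inv_atTop_zero.comp (tendsto_natCast_atTop_atTop.comp
      ((tendsto_add_atTop_nat N).comp hs.tendsto_atTop))
  have hcoord (i : ι) : Tendsto (fun m => y (s m) i) atTop (nhds (v i)) :=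
    ((by fun_prop : Continuous fun x : EuclideanSpace ℝ ι => x i).tendsto v).comp hlim
  have hBlim (i : ι) : Tendsto (fun m => B (y (s m)) (y (s m)) i) atTop (nhds (B v v i)) :=
    ((hcont i).tendsto v).comp hlim
  have hsum {x : EuclideanSpace ℝ ι} (hx : x ∈ Metric.sphere (0 : EuclideanSpace ℝ ι) 1) :
      ∑ i, x i ^ 2 = 1 := by
    rw [← EuclideanSpace.real_norm_sq_eq, mem_sphere_zero_iff_norm.1 hx, one_pow]
  have hceq (m : ℕ) : c m = ∑ i, (B (y m) (y m) i + ((m + N : ℕ) : ℝ)⁻¹ * y m i ^ 2) * y m i := by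
    have : ∀ i, (B (y m) (y m) i + ((m + N : ℕ) : ℝ)⁻¹ * y m i ^ 2) * y m i =
        c m * y m i ^ 2 := by
      intro i
      rw [hyc]
      ring
    simp only [this, ← Finset.mul_sum, hsum (hy m), mul_one]
  have hclim : Tendsto (fun m => c (s m)) atTop (nhds (∑ i, (B v v i + 0 * v i ^ 2) * v i)) := by
    simp only [hceq]
    exact tendsto_finsetSum _ fun i _ =>
      ((hBlim i).add (hinv.mul ((hcoord i).pow 2))).mul (hcoord i)
  set l := ∑ i, (B v v i + 0 * v i ^ 2) * v i
  have hl : 0 ≤ l := ge_of_tendsto' hclim fun m => hc _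
  have hBv : B v v = l • v := by
    ext i
    have h1 := (hclim.mul (hcoord i)).sub (hinv.mul ((hcoord i).pow 2))
    simp only [← hyc] at h1
    simpa using tendsto_nhds_unique (hBlim i) h1
  have hv0 : v ≠ 0 := by
    rintro rfl
    simp at hv
  refine ⟨v, hv0, l, hl.lt_of_ne fun h => hne v hv0 ?_, hBv⟩
  rw [hBv, ← h, zero_smul]

/-- (Sullivan–Gabber) If `Q x = B x x` is a homogeneous quadratic map on `ℝ^{n+1}`
(with `B` symmetric bilinear) which vanishes only at the origin, then the ODE
`dx/dt = Q x` exhibits finite time blowup for some initial condition. -/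
theorem stmt14 (n : ℕ)
    (B : EuclideanSpace ℝ (Fin (n + 1)) →ₗ[ℝ] EuclideanSpace ℝ (Fin (n + 1)) →ₗ[ℝ]
      EuclideanSpace ℝ (Fin (n + 1)))
    (hsymm : ∀ x y, B x y = B y x)
    (Q : EuclideanSpace ℝ (Fin (n + 1)) → EuclideanSpace ℝ (Fin (n + 1)))
    (hQ : ∀ x, Q x = B x x)
    (hne : ∀ x : EuclideanSpace ℝ (Fin (n + 1)), x ≠ 0 → Q x ≠ 0) :
    ∃ (A : EuclideanSpace ℝ (Fin (n + 1))) (T : ℝ)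
      (x : ℝ → EuclideanSpace ℝ (Fin (n + 1))),
      0 < T ∧ x 0 = A ∧
        (∀ t ∈ Set.Ico (0 : ℝ) T, HasDerivAt x (Q (x t)) t) ∧
        Tendsto (fun t => ‖x t‖) (nhdsWithin T (Set.Iio T)) atTop := by
  obtain ⟨y, hy, c, hc, hBy⟩ := exists_pos_quadratic_eigenvector B fun x hx => hQ x ▸ hne x hx
  refine ⟨y, c⁻¹, fun t => (1 - c * t)⁻¹ • y, inv_pos.2 hc, by simp, fun t ht => ?_, ?_⟩
  · have hpos : 1 - c * t ≠ 0 := by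
      have := mul_lt_mul_of_pos_left ht.2 hc
      rw [mul_inv_cancel₀ hc.ne'] at this
      linarith
    have hlin : HasDerivAt (fun t => 1 - c * t) (-c) t := by
      simpa using ((hasDerivAt_id t).const_mul c).const_sub 1
    refine ((hlin.fun_inv hpos).smul_const y).congr_deriv ?_
    rw [hQ]
    simp only [map_smul, LinearMap.smul_apply, hBy, smul_smul]
    congr 1
    field_simp
  · simp only [norm_smul]
    refine Tendsto.atTop_mul_const (norm_pos_iff.2 hy) ?_
    refine tendsto_norm_atTop_atTop.comp (tendsto_inv_nhdsGT_zero.comp ?_)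
    refine tendsto_nhdsWithin_iff.2 ⟨?_, ?_⟩
    · have h : Continuous fun t : ℝ => 1 - c * t := by fun_prop
      have := h.tendsto c⁻¹
      rw [mul_inv_cancel₀ hc.ne', sub_self] at this
      exact this.mono_left nhdsWithin_le_nhds
    · filter_upwards [self_mem_nhdsWithin] with t ht
      have := mul_lt_mul_of_pos_left (mem_Iio.1 ht) hc
      rw [mul_inv_cancel₀ hc.ne'] at this
      exact sub_pos.2 this
end
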